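/- The set of initial ideals of the Plücker ideal of Gr(3,6) arising from iterated sequences has exactly 240 elements: #{ In_{M_S}(𝓘_{3,6}) : S an iterated sequence for Gr(3,6) } = 240. -/

import Mathlib

/-!
Common framework: iterated sequences for Gr(3,n), the matrix `A_S`, pullbacks of
Plücker coordinates, the weighted reverse lexicographic order, lowest-term
valuations, Plücker relations, weighting matrices and initial ideals.
-/

open MvPolynomial

noncomputable section

/-- Height of a positive root `(i,j) ↦ j - i`. -/
def Ht (β : ℕ × ℕ) : ℕ := β.2 - β.1

/-- `IsIter n S` : `S` is an iterated sequence for `Gr(3,n)`: it starts (as base of the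
iteration) from a PBW sequence for `Gr(3,4)`, i.e. an ordering of `((1,4),(2,4),(3,4))`,
and for each `r = 5, …, n` a triple `((i₁,r),(i₂,r),(i₃,r))` with `i₁,i₂,i₃ ∈ [r-1]`
pairwise distinct is prepended. -/
inductive IsIter : ℕ → List (ℕ × ℕ) → Prop
  | base (L : List (ℕ × ℕ)) : L.Perm [(1,4),(2,4),(3,4)] → IsIter 4 L
  | step (r : ℕ) (L : List (ℕ × ℕ)) (i₁ i₂ i₃ : ℕ) :
      4 ≤ r → IsIter r L →
      1 ≤ i₁ → i₁ ≤ r → 1 ≤ i₂ → i₂ ≤ r → 1 ≤ i₃ → i₃ ≤ r →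
      i₁ ≠ i₂ → i₁ ≠ i₃ → i₂ ≠ i₃ →
      IsIter (r+1) ((i₁, r+1) :: (i₂, r+1) :: (i₃, r+1) :: L)

/-- `Sorted k n I` : `I ∈ I_{k,n}`, a strictly increasing `k`-tuple in `{1,…,n}`. -/
def Sorted (k n : ℕ) (I : Fin k → ℕ) : Prop :=
  StrictMono I ∧ ∀ a, 1 ≤ I a ∧ I a ≤ n

/-- `ℕ`-indexed square "matrices" (1-based indexing, size given by a parameter `n`). -/
abbrev NMat := ℕ → ℕ → MvPolynomial (ℕ × ℕ) ℂ

/-- Product of two `n × n` matrices, 1-based indexing. -/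
def matMul (n : ℕ) (A B : NMat) : NMat := fun i j => ∑ k ∈ Finset.Icc 1 n, A i k * B k j

/-- Identity matrix. -/
def idN : NMat := fun i j => if i = j then 1 else 0

/-- The factor `1 + x_β f_β`, where `f_β` is the matrix unit in entry `β = (i,j)`. -/
def factor (β : ℕ × ℕ) : NMat := fun i j =>
  (if i = j then (1 : MvPolynomial (ℕ × ℕ) ℂ) else 0) +
    (if i = β.1 ∧ j = β.2 then (MvPolynomial.X β : MvPolynomial (ℕ × ℕ) ℂ) else 0)

/-- `A_S := (1 + x_{β_N} f_{β_N}) ⋯ (1 + x_{β_1} f_{β_1})` for `S = (β_1, …, β_N)`. -/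
def ASmat (n : ℕ) : List (ℕ × ℕ) → NMat
  | [] => idN
  | β :: L => matMul n (ASmat n L) (factor β)

/-- `φ_S^*(p̄_I)` : the determinant of the `3×3` submatrix of `A_S` on rows `(1,2,3)`
and columns `I = (i₁,i₂,i₃)`. -/
def phiStar (n : ℕ) (S : List (ℕ × ℕ)) (I : Fin 3 → ℕ) : MvPolynomial (ℕ × ℕ) ℂ :=
  Matrix.det (Matrix.of fun a b : Fin 3 => ASmat n S (a.val + 1) (I b))

/-- `Ψ_S(a) = Σ_l a_l Ht(β_l)`, the height-weighted function (written on exponents). -/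
def Psi (d : (ℕ × ℕ) →₀ ℕ) : ℕ := d.sum fun β c => c * Ht β

/-- `a <_lex b` : lexicographic comparison of exponent vectors, the coordinates being
read in the order `β_1, …, β_N` of the sequence `S`. -/
def lexLT (S : List (ℕ × ℕ)) (a b : (ℕ × ℕ) →₀ ℕ) : Prop :=
  ∃ k < S.length, (∀ m < k, a (S.getD m (0,0)) = b (S.getD m (0,0))) ∧
    a (S.getD k (0,0)) < b (S.getD k (0,0))

/-- `a ≤_lex b` on coordinates indexed by `S`. -/
def lexLE (S : List (ℕ × ℕ)) (a b : (ℕ × ℕ) →₀ ℕ) : Prop :=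
  lexLT S a b ∨ ∀ k < S.length, a (S.getD k (0,0)) = b (S.getD k (0,0))

/-- `a ≺_{Ψ_S} b` : the strict `Ψ_S`-weighted reverse lexicographic order:
`Ψ_S(a) < Ψ_S(b)`, or `Ψ_S(a) = Ψ_S(b)` and `a >_lex b`. -/
def psiLT (S : List (ℕ × ℕ)) (a b : (ℕ × ℕ) →₀ ℕ) : Prop :=
  Psi a < Psi b ∨ (Psi a = Psi b ∧ lexLT S b a)

/-- `a ⪯_{Ψ_S} b`. -/
def psiLE (S : List (ℕ × ℕ)) (a b : (ℕ × ℕ) →₀ ℕ) : Prop :=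
  Psi a < Psi b ∨ (Psi a = Psi b ∧ lexLE S b a)

open scoped Classical in
/-- The `⪯_{Ψ_S}`-minimum of the support of a polynomial (defaulting to `0` if no
minimum exists). -/
def minSupp (S : List (ℕ × ℕ)) (f : MvPolynomial (ℕ × ℕ) ℂ) : (ℕ × ℕ) →₀ ℕ :=
  if h : ∃ m ∈ f.support, ∀ m' ∈ f.support, psiLE S m m' then h.choose else 0

/-- The lowest-term valuation `v_S(p̄_I)` : the `⪯_{Ψ_S}`-minimum of the support of
`φ_S^*(p̄_I)`. -/
def valS (n : ℕ) (S : List (ℕ × ℕ)) (I : Fin 3 → ℕ) : (ℕ × ℕ) →₀ ℕ :=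
  minSupp S (phiStar n S I)

/-- The index set `I_{3,n}` of Plücker variables. -/
abbrev MI (n : ℕ) := {v : Fin 3 → ℕ // Sorted 3 n v}

/-- The Plücker polynomial ring `ℂ[p_K : K ∈ I_{3,n}]`. -/
abbrev PRing (n : ℕ) := MvPolynomial (MI n) ℂ

open scoped Classical in
/-- The Plücker variable `p_K`, defined to be `0` if `K` is not strictly increasing
(in particular `p_{I ∪ j} = 0` if `j ∈ I`). -/
def pvar (n : ℕ) (K : Fin 3 → ℕ) : PRing n :=
  if h : Sorted 3 n K then MvPolynomial.X (⟨K, h⟩ : MI n) else 0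

/-- `I ∪ j` : the sorted triple obtained by adjoining `j` to the pair `I`. -/
def insert3 (I : Fin 2 → ℕ) (j : ℕ) : Fin 3 → ℕ :=
  fun a => (List.insertionSort (· ≤ ·) [I 0, I 1, j]).getD a 0

/-- `J ∖ j` : the sorted triple obtained by removing `j` from the 4-tuple `J`. -/
def erase4 (J : Fin 4 → ℕ) (j : ℕ) : Fin 3 → ℕ :=
  fun a => (([J 0, J 1, J 2, J 3]).erase j).getD a 0

/-- The Plücker relation
`R_{I,J} = Σ_{j ∈ J} (−1)^{#{i∈I : i<j} + #{j'∈J : j<j'}} p_{I∪j} p_{J∖j}`. -/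
def Rrel (n : ℕ) (I : Fin 2 → ℕ) (J : Fin 4 → ℕ) : PRing n :=
  ∑ a : Fin 4,
    (-1 : PRing n) ^ ((Finset.univ.filter fun b : Fin 2 => I b < J a).card +
        (Finset.univ.filter fun b : Fin 4 => J a < J b).card) *
      (pvar n (insert3 I (J a)) * pvar n (erase4 J (J a)))

/-- The Plücker ideal `𝓘_{3,n}`, generated by all Plücker relations. -/
def PluckerIdeal (n : ℕ) : Ideal (PRing n) :=
  Ideal.span {f | ∃ I J, Sorted 2 n I ∧ Sorted 4 n J ∧ f = Rrel n I J}

/-- `M_S · m = Σ_K m_K v_S(p̄_K)` : the weighting matrix applied to an exponent. -/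
def MSdot (n : ℕ) (S : List (ℕ × ℕ)) (m : MI n →₀ ℕ) : (ℕ × ℕ) →₀ ℕ :=
  m.sum fun K c => c • valS n S K.val

open scoped Classical in
/-- The initial form `In_{M_S}(f)` : the sum of the terms of `f` whose `M_S`-weight is
`⪯_{Ψ_S}`-minimal. -/
def inM (n : ℕ) (S : List (ℕ × ℕ)) (f : PRing n) : PRing n :=
  ∑ m ∈ f.support.filter fun m => ∀ m' ∈ f.support, psiLE S (MSdot n S m) (MSdot n S m'),
    MvPolynomial.monomial m (f.coeff m)

/-- The initial ideal `In_{M_S}(𝓘_{3,n}) = ⟨In_{M_S}(g) : g ∈ 𝓘_{3,n}, g ≠ 0⟩`. -/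
def InIdeal (n : ℕ) (S : List (ℕ × ℕ)) : Ideal (PRing n) :=
  Ideal.span {g | ∃ f, f ∈ PluckerIdeal n ∧ f ≠ 0 ∧ g = inM n S f}

/-- Evaluation of the `ℤ`-linear functional with coefficients `c` on an exponent
vector (i.e. an element `e ∈ (ℤ^{3(n-3)})^*` given by its coefficients). -/
def evalF (c : ℕ × ℕ → ℤ) (d : (ℕ × ℕ) →₀ ℕ) : ℤ := d.sum fun β m => c β * (m : ℤ)

/-- `v_S(p̄_{I∪j}) + v_S(p̄_{J∖j})`, the `M_S`-weight of the term of `R_{I,J}`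
corresponding to `j = J a`. -/
def wvec (n : ℕ) (S : List (ℕ × ℕ)) (I : Fin 2 → ℕ) (J : Fin 4 → ℕ) (a : Fin 4) :
    (ℕ × ℕ) →₀ ℕ :=
  valS n S (insert3 I (J a)) + valS n S (erase4 J (J a))

/-- A `ℤ`-linear functional `e` (given by its coefficients `c`) *preserves inequalities*
with respect to `S` if for every nonzero Plücker relation `R_{I,J}` and all
`s₁, s₂ ∈ J ∖ I`, `v_S(p̄_{I∪s₁}) + v_S(p̄_{J∖s₁}) ≺_{Ψ_S} v_S(p̄_{I∪s₂}) + v_S(p̄_{J∖s₂})`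
implies the corresponding strict inequality of the values of `e`. -/
def PreservesIneq (n : ℕ) (S : List (ℕ × ℕ)) (c : ℕ × ℕ → ℤ) : Prop :=
  ∀ (I : Fin 2 → ℕ) (J : Fin 4 → ℕ), Sorted 2 n I → Sorted 4 n J → Rrel n I J ≠ 0 →
    ∀ a b : Fin 4, (∀ t : Fin 2, I t ≠ J a) → (∀ t : Fin 2, I t ≠ J b) →
      psiLT S (wvec n S I J a) (wvec n S I J b) →
      evalF c (wvec n S I J a) < evalF c (wvec n S I J b)

end

section LexOrder

variable {S : List (ℕ × ℕ)} {β : ℕ × ℕ} {a b c : (ℕ × ℕ) →₀ ℕ}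

theorem lexLT_nil : ¬ lexLT [] a b := by
  rintro ⟨k, hk, -⟩
  simp at hk

theorem lexLT_cons : lexLT (β :: S) a b ↔ a β < b β ∨ a β = b β ∧ lexLT S a b := by
  constructor
  · rintro ⟨k, hk, h₁, h₂⟩
    cases k with
    | zero => exact Or.inl (by simpa using h₂)
    | succ k =>
      refine Or.inr ⟨by simpa using h₁ 0 (by omega), k, by simpa using hk, fun m hm => ?_, ?_⟩
      · simpa using h₁ (m + 1) (by omega)
      · simpa using h₂
  · rintro (h | ⟨h, k, hk, h₁, h₂⟩)
    · exact ⟨0, by simp, by simp, by simpa using h⟩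
    · refine ⟨k + 1, by simpa using hk, fun m hm => ?_, by simpa using h₂⟩
      cases m with
      | zero => simpa using h
      | succ m => simpa using h₁ m (by omega)

theorem lexLE_nil : lexLE [] a b := Or.inr (by simp)

theorem lexLE_cons : lexLE (β :: S) a b ↔ a β < b β ∨ a β = b β ∧ lexLE S a b := by
  have key : (∀ k < (β :: S).length, a ((β :: S).getD k (0,0)) = b ((β :: S).getD k (0,0))) ↔
      a β = b β ∧ ∀ k < S.length, a (S.getD k (0,0)) = b (S.getD k (0,0)) := by
    constructor
    · intro h
      exact ⟨by simpa using h 0 (by simp), fun k hk => by simpa using h (k + 1) (by simpa using hk)⟩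
    · rintro ⟨h₀, h⟩ k hk
      cases k with
      | zero => simpa using h₀
      | succ k => simpa using h k (by simpa using hk)
  rw [lexLE, key, lexLT_cons, lexLE]
  tauto

theorem lexLE_refl (S : List (ℕ × ℕ)) (a : (ℕ × ℕ) →₀ ℕ) : lexLE S a a := Or.inr fun _ _ => rfl

theorem lexLE_trans (h₁ : lexLE S a b) (h₂ : lexLE S b c) : lexLE S a c := by
  induction S with
  | nil => exact lexLE_nil
  | cons β S ih =>
    rw [lexLE_cons] at *
    rcases h₁ with h₁ | ⟨h₁, h₁'⟩ <;> rcases h₂ with h₂ | ⟨h₂, h₂'⟩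
    · omega
    · omega
    · omega
    · exact Or.inr ⟨h₁.trans h₂, ih h₁' h₂'⟩

theorem not_lexLE_of_lexLT (h : lexLT S a b) : ¬ lexLE S b a := by
  induction S with
  | nil => exact absurd h lexLT_nil
  | cons β S ih =>
    rw [lexLT_cons] at h
    rw [lexLE_cons]
    rintro (h' | ⟨h', h''⟩) <;> rcases h with h | ⟨h, hS⟩
    · omega
    · omega
    · omega
    · exact ih hS h''

theorem psiLE_refl (S : List (ℕ × ℕ)) (a : (ℕ × ℕ) →₀ ℕ) : psiLE S a a :=
  Or.inr ⟨rfl, lexLE_refl S a⟩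

theorem psiLE_trans (h₁ : psiLE S a b) (h₂ : psiLE S b c) : psiLE S a c := by
  rcases h₁ with h₁ | ⟨h₁, h₁'⟩ <;> rcases h₂ with h₂ | ⟨h₂, h₂'⟩
  · exact Or.inl (h₁.trans h₂)
  · exact Or.inl (h₂ ▸ h₁)
  · exact Or.inl (h₁ ▸ h₂)
  · exact Or.inr ⟨h₁.trans h₂, lexLE_trans h₂' h₁'⟩

theorem psiLE_of_psiLT (h : psiLT S a b) : psiLE S a b :=
  h.imp_right (And.imp_right Or.inl)

theorem not_psiLE_of_psiLT (h : psiLT S a b) : ¬ psiLE S b a := by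
  rcases h with h | ⟨h, h'⟩
  · rintro (h₁ | ⟨h₁, -⟩) <;> omega
  · rintro (h₁ | ⟨-, h₁⟩)
    · omega
    · exact not_lexLE_of_lexLT h' h₁

theorem psiLE_iff_of_psi_eq (h : Psi a = Psi b) : psiLE S a b ↔ lexLE S b a := by
  simp [psiLE, h]

/-- A strict minimum of the support is the value of `minSupp`. -/
theorem minSupp_eq {f : MvPolynomial (ℕ × ℕ) ℂ} (ha : a ∈ f.support)
    (h : ∀ b ∈ f.support, b ≠ a → psiLT S a b) : minSupp S f = a := by
  have hex : ∃ m ∈ f.support, ∀ m' ∈ f.support, psiLE S m m' := by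
    refine ⟨a, ha, fun b hb => ?_⟩
    rcases eq_or_ne b a with rfl | hne
    · exact psiLE_refl S b
    · exact psiLE_of_psiLT (h b hb hne)
  rw [minSupp, dif_pos hex]
  by_contra hne
  exact not_psiLE_of_psiLT (h _ hex.choose_spec.1 hne) (hex.choose_spec.2 a ha)

end LexOrder

section Psi

theorem Psi_add (a b : (ℕ × ℕ) →₀ ℕ) : Psi (a + b) = Psi a + Psi b :=
  Finsupp.sum_add_index' (by simp) (by intros; ring)

theorem Psi_single (β : ℕ × ℕ) : Psi (Finsupp.single β 1) = Ht β := by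
  simp [Psi]

end Psi

section Valuation

/-- The three roots `(i₁,n), (i₂,n), (i₃,n)`. -/
def block (n : ℕ) (i : Fin 3 → ℕ) : List (ℕ × ℕ) := [(i 0, n), (i 1, n), (i 2, n)]

/-- Three pairwise distinct indices in `{1,…,n-1}`. -/
def IsTriple (n : ℕ) (i : Fin 3 → ℕ) : Prop :=
  Function.Injective i ∧ ∀ t, 1 ≤ i t ∧ i t < n

/-- The first entry of `i` that does not lie in `K` (the last one if there is no other). -/
def rep (i : Fin 3 → ℕ) (K : Finset ℕ) : ℕ :=
  if i 0 ∉ K then i 0 else if i 1 ∉ K then i 1 else i 2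

/-- Replace `n` in `K` by the first entry of `i` that does not lie in `K`. -/
def reduce (n : ℕ) (i : Fin 3 → ℕ) (K : Finset ℕ) : Finset ℕ :=
  if n ∈ K then insert (rep i K) (K.erase n) else K

/-- The root used by `reduce`, as an exponent vector. -/
noncomputable def stepV (n : ℕ) (i : Fin 3 → ℕ) (K : Finset ℕ) : (ℕ × ℕ) →₀ ℕ :=
  if n ∈ K then Finsupp.single (rep i K, n) 1 else 0

/-- `v` is the lexicographically largest exponent of `f`, all exponents of `f` have height
`s - 6` and involve only roots `(c,n)` with `n ≤ r`. -/
structure IsLead (S : List (ℕ × ℕ)) (r s : ℕ) (f : MvPolynomial (ℕ × ℕ) ℂ)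
    (v : (ℕ × ℕ) →₀ ℕ) : Prop where
  mem : v ∈ f.support
  psi : ∀ m ∈ f.support, Psi m + 6 = s
  top : ∀ m ∈ f.support, ∀ c n, r < n → m (c, n) = 0
  lex : ∀ m ∈ f.support, m ≠ v → lexLT S m v

theorem IsLead.minSupp_eq {S : List (ℕ × ℕ)} {r s : ℕ} {f : MvPolynomial (ℕ × ℕ) ℂ}
    {v : (ℕ × ℕ) →₀ ℕ} (h : IsLead S r s f v) : minSupp S f = v := by
  refine _root_.minSupp_eq h.mem fun b hb hne => Or.inr ⟨?_, h.lex b hb hne⟩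
  have h₁ := h.psi _ hb
  have h₂ := h.psi _ h.mem
  omega

theorem ASmat_cons {n i j : ℕ} {β : ℕ × ℕ} (L : List (ℕ × ℕ)) (hj : j ∈ Finset.Icc 1 n)
    (hβ : β.1 ∈ Finset.Icc 1 n) :
    ASmat n (β :: L) i j =
      ASmat n L i j + if j = β.2 then X β * ASmat n L i β.1 else 0 := by
  rw [ASmat, matMul]
  simp only [factor, mul_add, Finset.sum_add_distrib, mul_ite, mul_one, mul_zero,
    Finset.sum_ite_eq', hj, if_true]
  congr 1
  by_cases h : j = β.2
  · simp [h, mul_comm]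
    intro h'
    simp only [Finset.mem_Icc] at hβ
    omega
  · simp [h]

variable {r : ℕ} {i : Fin 3 → ℕ} {L : List (ℕ × ℕ)}

theorem ASmat_block_of_ne {a j : ℕ} (hr : r < 6) (hi : IsTriple (r + 1) i)
    (hj : j ∈ Finset.Icc 1 6) (hne : j ≠ r + 1) :
    ASmat 6 (block (r + 1) i ++ L) a j = ASmat 6 L a j := by
  have hi' : ∀ t, i t ∈ Finset.Icc 1 6 := fun t => by
    have := hi.2 t
    simp only [Finset.mem_Icc]; omega
  simp only [block, List.cons_append, List.nil_append]
  rw [ASmat_cons _ hj (hi' 0), ASmat_cons _ hj (hi' 1), ASmat_cons _ hj (hi' 2)]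
  simp [hne]

theorem ASmat_block_self {a : ℕ} (hr : r < 6) (hi : IsTriple (r + 1) i) :
    ASmat 6 (block (r + 1) i ++ L) a (r + 1) =
      ASmat 6 L a (r + 1) + ∑ t, X (i t, r + 1) * ASmat 6 L a (i t) := by
  have hi' : ∀ t, i t ∈ Finset.Icc 1 6 := fun t => by
    have := hi.2 t
    simp only [Finset.mem_Icc]; omega
  have hne : ∀ t, i t ≠ r + 1 := fun t => (hi.2 t).2.ne
  have hr' : r + 1 ∈ Finset.Icc 1 6 := by simp only [Finset.mem_Icc]; omega
  simp only [block, List.cons_append, List.nil_append, Fin.sum_univ_three]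
  rw [ASmat_cons _ hr' (hi' 0), ASmat_cons _ hr' (hi' 1), ASmat_cons _ hr' (hi' 2),
    ASmat_cons _ (hi' 0) (hi' 1), ASmat_cons _ (hi' 0) (hi' 2), ASmat_cons _ (hi' 1) (hi' 2)]
  simp only [hne, if_true, if_false, add_zero]
  ring

theorem phiStar_congr {S T : List (ℕ × ℕ)} {I J : Fin 3 → ℕ}
    (h : ∀ a b, ASmat 6 S a (I b) = ASmat 6 T a (J b)) : phiStar 6 S I = phiStar 6 T J := by
  simp only [phiStar, h]

theorem phiStar_rotate (S : List (ℕ × ℕ)) (x y z : ℕ) :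
    phiStar 6 S ![x, y, z] = phiStar 6 S ![y, z, x] := by
  simp only [phiStar, Matrix.det_fin_three, Matrix.of_apply, Matrix.cons_val]
  ring

theorem phiStar_eq_zero (S : List (ℕ × ℕ)) {x y z : ℕ} (h : z = x ∨ z = y) :
    phiStar 6 S ![x, y, z] = 0 := by
  simp only [phiStar, Matrix.det_fin_three, Matrix.of_apply, Matrix.cons_val]
  rcases h with rfl | rfl <;> ring

theorem phiStar_block (hr : r < 6) (hi : IsTriple (r + 1) i)
    (hL : ∀ a < 3, ASmat 6 L (a + 1) (r + 1) = 0) {x y : ℕ} (hx : x ∈ Finset.Icc 1 r)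
    (hy : y ∈ Finset.Icc 1 r) :
    phiStar 6 (block (r + 1) i ++ L) ![x, y, r + 1] =
      ∑ t, X (i t, r + 1) * phiStar 6 L ![x, y, i t] := by
  simp only [Finset.mem_Icc] at hx hy
  have h0 := hL 0 (by omega)
  have h1 := hL 1 (by omega)
  have h2 := hL 2 (by omega)
  have hx' (a) : ASmat 6 (block (r + 1) i ++ L) a x = ASmat 6 L a x :=
    ASmat_block_of_ne hr hi (by simp only [Finset.mem_Icc]; omega) (by omega)
  have hy' (a) : ASmat 6 (block (r + 1) i ++ L) a y = ASmat 6 L a y :=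
    ASmat_block_of_ne hr hi (by simp only [Finset.mem_Icc]; omega) (by omega)
  simp only [phiStar, Matrix.det_fin_three, Matrix.of_apply, Matrix.cons_val, hx', hy',
    ASmat_block_self hr hi, Fin.sum_univ_three, Fin.val_zero, Fin.val_one, Fin.val_two, h0, h1, h2]
  ring

theorem exists_rep_eq {K : Finset ℕ} {n x y : ℕ} (hi : IsTriple n i)
    (hK : ∀ t, i t ∈ K ↔ i t = x ∨ i t = y) :
    ∃ t₀, rep i K = i t₀ ∧ i t₀ ≠ x ∧ i t₀ ≠ y ∧ ∀ t < t₀, i t = x ∨ i t = y := by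
  have h01 : i 0 ≠ i 1 := hi.1.ne (by decide)
  have h02 : i 0 ≠ i 2 := hi.1.ne (by decide)
  have h12 : i 1 ≠ i 2 := hi.1.ne (by decide)
  simp only [rep, hK, ite_not]
  by_cases h0 : i 0 = x ∨ i 0 = y
  · by_cases h1 : i 1 = x ∨ i 1 = y
    · refine ⟨2, by simp [h0, h1], by omega, by omega, fun t ht => ?_⟩
      fin_cases t <;> simp_all
    · refine ⟨1, by simp [h0, h1], by tauto, by tauto, fun t ht => ?_⟩
      fin_cases t <;> simp_all
  · refine ⟨0, by simp [h0], by tauto, by tauto, fun t ht => ?_⟩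
    simp at ht

theorem lexLT_block {n : ℕ} (hi : IsTriple n i) {m v : (ℕ × ℕ) →₀ ℕ} (hm : ∀ c, m (c, n) = 0)
    (hv : ∀ c, v (c, n) = 0) {t₀ t : Fin 3} (h : t₀ < t) :
    lexLT (block n i ++ L) (Finsupp.single (i t, n) 1 + m) (Finsupp.single (i t₀, n) 1 + v) := by
  have h01 : i 0 ≠ i 1 := hi.1.ne (by decide)
  have h02 : i 0 ≠ i 2 := hi.1.ne (by decide)
  have h12 : i 1 ≠ i 2 := hi.1.ne (by decide)
  fin_cases t₀ <;> fin_cases t <;>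
    simp_all [block, lexLT_cons, h01.symm, h02.symm, h12.symm]

theorem lexLT_block_append {n : ℕ} (u : (ℕ × ℕ) →₀ ℕ) {m v : (ℕ × ℕ) →₀ ℕ}
    (hm : ∀ c, m (c, n) = 0) (hv : ∀ c, v (c, n) = 0) (hu : ∀ β ∈ L, u β = 0)
    (h : lexLT L m v) : lexLT (block n i ++ L) (u + m) (u + v) := by
  have hL : lexLT L (u + m) (u + v) := by
    obtain ⟨k, hk, h₁, h₂⟩ := h
    have hu' : ∀ l < L.length, u (L.getD l (0, 0)) = 0 := fun l hl => by
      rw [List.getD_eq_getElem _ _ hl]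
      exact hu _ (List.getElem_mem hl)
    refine ⟨k, hk, fun l hl => ?_, ?_⟩
    · simp [-List.getD_eq_getElem?_getD, hu' l (hl.trans hk), h₁ l hl]
    · simpa [-List.getD_eq_getElem?_getD, hu' k hk] using h₂
  simp [block, lexLT_cons, hm, hv, hL]

end Valuation

section Lead

variable {r : ℕ} {i : Fin 3 → ℕ} {L : List (ℕ × ℕ)} {V : Finset ℕ → (ℕ × ℕ) →₀ ℕ}

/-- `V` gives the leading exponents of all Plücker coordinates with indices at most `r`. -/
def IsLeadFamily (L : List (ℕ × ℕ)) (r : ℕ) (V : Finset ℕ → (ℕ × ℕ) →₀ ℕ) : Prop :=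
  ∀ x y z, x ∈ Finset.Icc 1 r → y ∈ Finset.Icc 1 r → z ∈ Finset.Icc 1 r →
    x ≠ y → x ≠ z → y ≠ z → IsLead L r (x + y + z) (phiStar 6 L ![x, y, z]) (V {x, y, z})

theorem isLead_block_last (hr : r < 6) (hi : IsTriple (r + 1) i)
    (hL0 : ∀ a < 3, ASmat 6 L (a + 1) (r + 1) = 0) (hLr : ∀ β ∈ L, β.2 ≤ r)
    (hL : IsLeadFamily L r V) {x y : ℕ} (hx : x ∈ Finset.Icc 1 r) (hy : y ∈ Finset.Icc 1 r)
    (hxy : x ≠ y) :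
    IsLead (block (r + 1) i ++ L) (r + 1) (x + y + (r + 1))
      (phiStar 6 (block (r + 1) i ++ L) ![x, y, r + 1])
      (stepV (r + 1) i {x, y, r + 1} + V (reduce (r + 1) i {x, y, r + 1})) := by
  have hxr := (Finset.mem_Icc.1 hx).2
  have hyr := (Finset.mem_Icc.1 hy).2
  obtain ⟨t₀, ht₀, hx₀, hy₀, hlt⟩ := exists_rep_eq (K := {x, y, r + 1}) (x := x) (y := y) hi
    (fun t => by have := (hi.2 t).2.ne; simp [this])
  have hred : reduce (r + 1) i {x, y, r + 1} = {x, y, i t₀} := by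
    ext c
    simp only [reduce, ht₀]
    simp
    omega
  have hstep : stepV (r + 1) i {x, y, r + 1} = Finsupp.single (i t₀, r + 1) 1 := by
    simp [stepV, ht₀]
  have hlead : ∀ t, i t ≠ x → i t ≠ y →
      IsLead L r (x + y + i t) (phiStar 6 L ![x, y, i t]) (V {x, y, i t}) := fun t h₁ h₂ =>
    hL x y (i t) hx hy (by have := hi.2 t; simp only [Finset.mem_Icc]; omega) hxy h₁.symm h₂.symm
  have hlead₀ := hlead t₀ hx₀ hy₀
  rw [hred, hstep, phiStar_block hr hi hL0 hx hy]
  set v := V {x, y, i t₀} with hv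
  have hvtop : ∀ c, v (c, r + 1) = 0 := fun c => hlead₀.top v hlead₀.mem c _ (by omega)
  have hsupp : ∀ m ∈ (∑ t, X (i t, r + 1) * phiStar 6 L ![x, y, i t]).support,
      ∃ t m', m = Finsupp.single (i t, r + 1) 1 + m' ∧ t₀ ≤ t ∧ i t ≠ x ∧ i t ≠ y ∧
        m' ∈ (phiStar 6 L ![x, y, i t]).support := by
    intro m hm
    obtain ⟨t, -, ht⟩ := Finset.mem_biUnion.1 (MvPolynomial.support_sum hm)
    rw [MvPolynomial.support_X_mul, Finset.mem_map] at ht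
    obtain ⟨m', hm', rfl⟩ := ht
    have hne : ¬ (i t = x ∨ i t = y) := fun h => by
      rw [phiStar_eq_zero L h] at hm'
      simp at hm'
    refine ⟨t, m', rfl, ?_, by tauto, by tauto, hm'⟩
    by_contra hlt'
    exact hne (hlt t (not_le.1 hlt'))
  refine ⟨?_, fun m hm => ?_, fun m hm c n hn => ?_, fun m hm hne => ?_⟩
  · rw [MvPolynomial.mem_support_iff, MvPolynomial.coeff_sum, Finset.sum_eq_single t₀]
    · rw [MvPolynomial.coeff_X_mul]
      exact MvPolynomial.mem_support_iff.1 hlead₀.mem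
    · intro t _ ht
      rw [MvPolynomial.coeff_X_mul', if_neg]
      have := hi.1.ne ht
      simp [hvtop, this.symm]
    · simp
  · obtain ⟨t, m', rfl, -, h₁, h₂, hm'⟩ := hsupp m hm
    have h := (hlead t h₁ h₂).psi m' hm'
    have h' := hi.2 t
    rw [Psi_add, Psi_single, Ht]
    simp only
    omega
  · obtain ⟨t, m', rfl, -, h₁, h₂, hm'⟩ := hsupp m hm
    have h := (hlead t h₁ h₂).top m' hm' c n (by omega)
    have hne : r + 1 ≠ n := hn.ne
    simp [h, hne]
  · obtain ⟨t, m', rfl, h₀, h₁, h₂, hm'⟩ := hsupp m hm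
    have hm'top : ∀ c, m' (c, r + 1) = 0 := fun c => (hlead t h₁ h₂).top m' hm' c _ (by omega)
    rcases h₀.eq_or_lt with rfl | h₀
    · refine lexLT_block_append _ hm'top hvtop (fun β hβ => ?_) (hlead₀.lex m' hm' ?_)
      · have := hLr β hβ
        rw [Finsupp.single_apply, if_neg]
        rintro rfl
        simp at this
      · rintro rfl
        exact hne rfl
    · exact lexLT_block hi hm'top hvtop h₀

theorem isLeadFamily_block (hr : r < 6) (hi : IsTriple (r + 1) i)
    (hL0 : ∀ a < 3, ASmat 6 L (a + 1) (r + 1) = 0) (hLr : ∀ β ∈ L, β.2 ≤ r)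
    (hL : IsLeadFamily L r V) :
    IsLeadFamily (block (r + 1) i ++ L) (r + 1)
      fun K => stepV (r + 1) i K + V (reduce (r + 1) i K) := by
  have hlt : ∀ x ∈ Finset.Icc 1 (r + 1), x ≠ r + 1 → x ∈ Finset.Icc 1 r := fun x hx h => by
    simp only [Finset.mem_Icc] at *; omega
  intro x y z hx hy hz hxy hxz hyz
  rcases eq_or_ne z (r + 1) with rfl | hz'
  · exact isLead_block_last hr hi hL0 hLr hL (hlt x hx hxz) (hlt y hy hyz) hxy
  rcases eq_or_ne y (r + 1) with rfl | hy'
  · have h := isLead_block_last hr hi hL0 hLr hL (hlt z hz hz') (hlt x hx hxy) hxz.symm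
    rw [phiStar_rotate, show ({z, x, r + 1} : Finset ℕ) = {x, r + 1, z} by ext; simp; tauto,
      show z + x + (r + 1) = x + (r + 1) + z by ring] at h
    exact h
  rcases eq_or_ne x (r + 1) with rfl | hx'
  · have h := isLead_block_last hr hi hL0 hLr hL (hlt y hy hy') (hlt z hz hz') hyz
    rw [← phiStar_rotate, show ({y, z, r + 1} : Finset ℕ) = {r + 1, y, z} by ext; simp; tauto,
      show y + z + (r + 1) = r + 1 + y + z by ring] at h
    exact h
  have hnot : r + 1 ∉ ({x, y, z} : Finset ℕ) := by simp; tauto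
  have hphi : phiStar 6 (block (r + 1) i ++ L) ![x, y, z] = phiStar 6 L ![x, y, z] := by
    refine phiStar_congr fun a b => ?_
    have h6 : ∀ c ∈ Finset.Icc 1 (r + 1), c ∈ Finset.Icc 1 6 := fun c hc => by
      simp only [Finset.mem_Icc] at *; omega
    fin_cases b
    · exact ASmat_block_of_ne hr hi (h6 x hx) hx'
    · exact ASmat_block_of_ne hr hi (h6 y hy) hy'
    · exact ASmat_block_of_ne hr hi (h6 z hz) hz'
  have h := hL x y z (hlt x hx hx') (hlt y hy hy') (hlt z hz hz') hxy hxz hyz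
  simp only [stepV, reduce, hnot, if_false, zero_add, hphi]
  refine ⟨h.mem, h.psi, fun m hm c n hn => h.top m hm c n (by omega), fun m hm hne => ?_⟩
  have h0 : ∀ m ∈ (phiStar 6 L ![x, y, z]).support, ∀ c, m (c, r + 1) = 0 :=
    fun m hm c => h.top m hm c _ (by omega)
  simpa using lexLT_block_append (i := i) 0 (h0 m hm) (h0 _ h.mem) (by simp) (h.lex m hm hne)

theorem isLeadFamily_nil : IsLeadFamily [] 3 fun _ => 0 := by
  intro x y z hx hy hz hxy hxz hyz
  simp only [Finset.mem_Icc] at hx hy hz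
  have hdet : phiStar 6 [] ![x, y, z] = 1 ∨ phiStar 6 [] ![x, y, z] = -1 := by
    obtain ⟨hx₁, hx₂⟩ := hx
    obtain ⟨hy₁, hy₂⟩ := hy
    obtain ⟨hz₁, hz₂⟩ := hz
    interval_cases x <;> interval_cases y <;> first | omega | skip
    all_goals
      interval_cases z <;> first | omega | simp [phiStar, Matrix.det_fin_three, ASmat, idN]
  have hsupp : (phiStar 6 [] ![x, y, z]).support = {0} := by
    rcases hdet with h | h <;> rw [h]
    · exact MvPolynomial.support_one
    · rw [MvPolynomial.support_neg, MvPolynomial.support_one]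
  have hsum : x + y + z = 6 := by omega
  refine ⟨by simp [hsupp], ?_, ?_, ?_⟩ <;> simp [hsupp, hsum, Psi]

end Lead

section Sequence

/-- The sequence with top triple `j`, middle triple `i` and base triple `k`. -/
def seq (j i k : Fin 3 → ℕ) : List (ℕ × ℕ) := block 6 j ++ (block 5 i ++ (block 4 k ++ []))

/-- The triples `j`, `i`, `k` define an iterated sequence. -/
def IsSeq (j i k : Fin 3 → ℕ) : Prop := IsTriple 6 j ∧ IsTriple 5 i ∧ IsTriple 4 k

/-- The valuation of the Plücker coordinate indexed by `K`. -/
noncomputable def valSet (j i k : Fin 3 → ℕ) (K : Finset ℕ) : (ℕ × ℕ) →₀ ℕ :=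
  stepV 6 j K + (stepV 5 i (reduce 6 j K) + stepV 4 k (reduce 5 i (reduce 6 j K)))

variable {j i k : Fin 3 → ℕ}

theorem ASmat_block_zero {r : ℕ} {L : List (ℕ × ℕ)} (hr : r < 6) (hi : IsTriple (r + 1) i)
    (hL : ∀ a < 3, ∀ c ∈ Finset.Icc (r + 1) 6, ASmat 6 L (a + 1) c = 0) :
    ∀ a < 3, ∀ c ∈ Finset.Icc (r + 2) 6, ASmat 6 (block (r + 1) i ++ L) (a + 1) c = 0 := by
  intro a ha c hc
  simp only [Finset.mem_Icc] at hc
  rw [ASmat_block_of_ne hr hi (by simp only [Finset.mem_Icc]; omega) (by omega)]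
  exact hL a ha c (by simp only [Finset.mem_Icc]; omega)

theorem isLeadFamily_seq (h : IsSeq j i k) : IsLeadFamily (seq j i k) 6 (valSet j i k) := by
  obtain ⟨hj, hi, hk⟩ := h
  have h3 : ∀ a < 3, ∀ c ∈ Finset.Icc 4 6, ASmat 6 [] (a + 1) c = 0 := fun a ha c hc => by
    simp only [Finset.mem_Icc] at hc
    simp only [ASmat, idN, ite_eq_right_iff]
    omega
  have h4 := ASmat_block_zero (by omega) hk h3
  have h5 := ASmat_block_zero (by omega) hi h4
  have l3 := isLeadFamily_block (by omega) hk (fun a ha => h3 a ha _ (by simp)) (by simp)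
    isLeadFamily_nil
  have l4 := isLeadFamily_block (by omega) hi (fun a ha => h4 a ha _ (by simp)) (by simp [block]) l3
  have l5 := isLeadFamily_block (by omega) hj (fun a ha => h5 a ha _ (by simp)) (by simp [block]) l4
  simp only [add_zero] at l5
  exact l5

/-- The set of entries of a Plücker index. -/
def MI.toFinset {n : ℕ} (K : MI n) : Finset ℕ := Finset.univ.image K.1

theorem valS_seq (h : IsSeq j i k) (K : MI 6) : valS 6 (seq j i k) K.1 = valSet j i k K.toFinset := by
  obtain ⟨K, hK, hK'⟩ := K
  have h01 : K 0 ≠ K 1 := hK.injective.ne (by decide)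
  have h02 : K 0 ≠ K 2 := hK.injective.ne (by decide)
  have h12 : K 1 ≠ K 2 := hK.injective.ne (by decide)
  have hmem : ∀ t, K t ∈ Finset.Icc 1 6 := fun t => Finset.mem_Icc.2 (hK' t)
  have hlead := isLeadFamily_seq h _ _ _ (hmem 0) (hmem 1) (hmem 2) h01 h02 h12
  have hK3 : ![K 0, K 1, K 2] = K := by ext t; fin_cases t <;> rfl
  have hset : MI.toFinset (⟨K, hK, hK'⟩ : MI 6) = {K 0, K 1, K 2} := by
    ext c; simp [MI.toFinset, Fin.exists_fin_succ, eq_comm]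
  rw [hset, valS, ← hlead.minSupp_eq, hK3]

theorem isIter_iff {S : List (ℕ × ℕ)} : IsIter 6 S ↔ ∃ j i k, IsSeq j i k ∧ S = seq j i k := by
  have htriple : ∀ {n a b c : ℕ}, 1 ≤ a → a ≤ n → 1 ≤ b → b ≤ n → 1 ≤ c → c ≤ n → a ≠ b → a ≠ c →
      b ≠ c → IsTriple (n + 1) ![a, b, c] := by
    intro n a b c ha ha' hb hb' hc hc' hab hac hbc
    constructor
    · intro s t hst
      fin_cases s <;> fin_cases t <;> simp_all
    · intro t
      fin_cases t <;> simp <;> omega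
  constructor
  · intro h
    cases h with
    | step _ L j₁ j₂ j₃ _ h a1 a2 a3 a4 a5 a6 a7 a8 a9 =>
    cases h with
    | step _ L i₁ i₂ i₃ _ h b1 b2 b3 b4 b5 b6 b7 b8 b9 =>
    have hbase : ∃ k, IsTriple 4 k ∧ L = block 4 k ++ [] := by
      cases h with
      | step _ _ _ _ _ h => omega
      | base _ h =>
        have := List.mem_permutations.2 h
        simp [List.permutations] at this
        rcases this with rfl | rfl | rfl | rfl | rfl | rfl
        · exact ⟨![1, 2, 3], by unfold IsTriple; decide, rfl⟩
        · exact ⟨![2, 1, 3], by unfold IsTriple; decide, rfl⟩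
        · exact ⟨![3, 2, 1], by unfold IsTriple; decide, rfl⟩
        · exact ⟨![2, 3, 1], by unfold IsTriple; decide, rfl⟩
        · exact ⟨![3, 1, 2], by unfold IsTriple; decide, rfl⟩
        · exact ⟨![1, 3, 2], by unfold IsTriple; decide, rfl⟩
    obtain ⟨k, hk, rfl⟩ := hbase
    exact ⟨![j₁, j₂, j₃], ![i₁, i₂, i₃], k,
      ⟨htriple a1 a2 a3 a4 a5 a6 a7 a8 a9, htriple b1 b2 b3 b4 b5 b6 b7 b8 b9, hk⟩, rfl⟩
  · rintro ⟨j, i, k, ⟨hj, hi, hk⟩, rfl⟩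
    have hne : ∀ {n : ℕ} {i : Fin 3 → ℕ}, IsTriple n i → i 0 ≠ i 1 ∧ i 0 ≠ i 2 ∧ i 1 ≠ i 2 :=
      fun h => ⟨h.1.ne (by decide), h.1.ne (by decide), h.1.ne (by decide)⟩
    have hle : ∀ {n : ℕ} {i : Fin 3 → ℕ}, IsTriple (n + 1) i → ∀ t, 1 ≤ i t ∧ i t ≤ n :=
      fun h t => ⟨(h.2 t).1, Nat.lt_succ_iff.1 (h.2 t).2⟩
    refine IsIter.step 5 _ _ _ _ (by omega) (IsIter.step 4 _ _ _ _ (by omega) (IsIter.base _ ?_)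
      (hle hi 0).1 (hle hi 0).2 (hle hi 1).1 (hle hi 1).2 (hle hi 2).1 (hle hi 2).2
      (hne hi).1 (hne hi).2.1 (hne hi).2.2)
      (hle hj 0).1 (hle hj 0).2 (hle hj 1).1 (hle hj 1).2 (hle hj 2).1 (hle hj 2).2
      (hne hj).1 (hne hj).2.1 (hne hj).2.2
    refine (List.perm_ext_iff_of_nodup ?_ (by decide)).2 ?_
    · have := hne hk
      simp [block]; tauto
    · rintro ⟨c, d⟩
      have h := hne hk
      have h0 := hk.2 0
      have h1 := hk.2 1
      have h2 := hk.2 2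
      simp [block]
      omega

end Sequence

section Weight

theorem finsupp_nat_induction {σ : Type*} {P : (σ →₀ ℕ) → Prop} (zero : P 0)
    (add : ∀ a b, P a → P b → P (a + b)) (single : ∀ K, P (Finsupp.single K 1)) (m : σ →₀ ℕ) :
    P m := by
  induction m using Finsupp.induction_linear with
  | zero => exact zero
  | add a b ha hb => exact add a b ha hb
  | single K c =>
    induction c with
    | zero => simpa using zero
    | succ c ih =>
      rw [Finsupp.single_add]
      exact add _ _ ih (single K)

variable {n : ℕ} {S : List (ℕ × ℕ)}

theorem MSdot_zero : MSdot n S 0 = 0 := Finsupp.sum_zero_index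

theorem MSdot_add (a b : MI n →₀ ℕ) : MSdot n S (a + b) = MSdot n S a + MSdot n S b :=
  Finsupp.sum_add_index' (by simp) fun _ _ _ => add_smul _ _ _

theorem MSdot_single (K : MI n) : MSdot n S (Finsupp.single K 1) = valS n S K.1 := by
  simp [MSdot]

/-- The indicator function of a finite set of natural numbers. -/
def ind (K : Finset ℕ) (c : ℕ) : ℕ := if c ∈ K then 1 else 0

/-- The multidegree of a monomial in the Plücker variables. -/
noncomputable def mdeg (m : MI n →₀ ℕ) : ℕ → ℕ :=
  Finsupp.weight (fun K : MI n => ind K.toFinset) m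

theorem mdeg_zero : mdeg (0 : MI n →₀ ℕ) = 0 := map_zero _

theorem mdeg_add (a b : MI n →₀ ℕ) : mdeg (a + b) = mdeg a + mdeg b := map_add _ _ _

theorem mdeg_single (K : MI n) : mdeg (Finsupp.single K 1) = ind K.toFinset := by
  simp [mdeg, Finsupp.weight_single]

theorem card_toFinset (K : MI n) : K.toFinset.card = 3 := by
  rw [MI.toFinset, Finset.card_image_of_injective _ K.2.1.injective]
  simp

theorem toFinset_subset (K : MI n) : K.toFinset ⊆ Finset.Icc 1 n := by
  intro c hc
  obtain ⟨t, -, rfl⟩ := Finset.mem_image.1 hc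
  exact Finset.mem_Icc.2 (K.2.2 t)

end Weight

section Step

variable {n : ℕ} {i : Fin 3 → ℕ} {K : Finset ℕ}

theorem IsTriple.ne (h : IsTriple n i) : i 0 ≠ i 1 ∧ i 0 ≠ i 2 ∧ i 1 ≠ i 2 :=
  ⟨h.1.ne (by decide), h.1.ne (by decide), h.1.ne (by decide)⟩

theorem stepV_apply (c n' : ℕ) :
    stepV n i K (c, n') = if n ∈ K ∧ n' = n ∧ c = rep i K then 1 else 0 := by
  unfold stepV
  by_cases h : n ∈ K
  · simp only [h, if_true, true_and, Finsupp.single_apply, Prod.mk.injEq]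
    congr 1
    simp only [eq_iff_iff]
    tauto
  · simp [h]

theorem exists_rep (i : Fin 3 → ℕ) (K : Finset ℕ) : ∃ t, rep i K = i t := by
  by_cases h0 : i 0 ∈ K
  · by_cases h1 : i 1 ∈ K
    · exact ⟨2, by simp [rep, h0, h1]⟩
    · exact ⟨1, by simp [rep, h0, h1]⟩
  · exact ⟨0, by simp [rep, h0]⟩

theorem rep_notMem (hi : IsTriple n i) (hK : K.card = 3) (hn : n ∈ K) : rep i K ∉ K := by
  by_cases h0 : i 0 ∈ K
  · by_cases h1 : i 1 ∈ K
    · simp only [rep, h0, h1, not_true, if_false]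
      intro h2
      have hsub : insert n (Finset.univ.image i) ⊆ K := by
        simp [Finset.insert_subset_iff, Finset.image_subset_iff, Fin.forall_fin_succ, hn, h0, h1, h2]
      have := Finset.card_le_card hsub
      rw [Finset.card_insert_of_notMem, Finset.card_image_of_injective _ hi.1, hK] at this
      · simp at this
      · simp only [Finset.mem_image, Finset.mem_univ, true_and, not_exists]
        exact fun t => (hi.2 t).2.ne
    · simp [rep, h0, h1]
  · simp [rep, h0]

theorem card_reduce (hi : IsTriple n i) (hK : K.card = 3) : (reduce n i K).card = 3 := by
  unfold reduce
  split_ifs with hn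
  · have := rep_notMem hi hK hn
    rw [Finset.card_insert_of_notMem (by simp [this]), Finset.card_erase_of_mem hn, hK]
  · exact hK

theorem reduce_subset (hi : IsTriple (n + 1) i) (hK : K ⊆ Finset.Icc 1 (n + 1)) :
    reduce (n + 1) i K ⊆ Finset.Icc 1 n := by
  obtain ⟨t, ht⟩ := exists_rep i K
  have := hi.2 t
  intro c hc
  unfold reduce at hc
  split_ifs at hc with hn
  · simp only [ht, Finset.mem_insert, Finset.mem_erase] at hc
    rcases hc with rfl | ⟨h, hc⟩
    · simp; omega
    · have := hK hc
      simp only [Finset.mem_Icc] at *; omega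
  · have h := hK hc
    have : c ≠ n + 1 := fun h => hn (h ▸ hc)
    simp only [Finset.mem_Icc] at *; omega

theorem ind_reduce (hi : IsTriple n i) (hK : K.card = 3) {c : ℕ} (hc : c ≠ n) :
    ind (reduce n i K) c = ind K c + stepV n i K (c, n) := by
  rw [stepV_apply]
  unfold ind reduce
  by_cases hn : n ∈ K
  · have := rep_notMem hi hK hn
    by_cases h : c = rep i K
    · subst h; simp [hn, this]
    · simp [hn, h, hc]
  · simp [hn]

theorem sum_stepV (hi : IsTriple n i) :
    stepV n i K (i 0, n) + stepV n i K (i 1, n) + stepV n i K (i 2, n) = ind K n := by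
  have h := hi.ne
  obtain ⟨t, ht⟩ := exists_rep i K
  simp only [stepV_apply, ind, ht]
  by_cases hn : n ∈ K
  · fin_cases t <;> simp [hn, h.1, h.2.1, h.2.2, h.1.symm, h.2.1.symm, h.2.2.symm]
  · simp [hn]

theorem stepV_eq_zero {c : ℕ} (hc : ∀ t, c ≠ i t) (n' : ℕ) : stepV n i K (c, n') = 0 := by
  obtain ⟨t, ht⟩ := exists_rep i K
  simp [stepV_apply, ht, hc]

theorem stepV_of_ne {c n' : ℕ} (h : n' ≠ n) : stepV n i K (c, n') = 0 := by
  simp [stepV_apply, h]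

/-- The first two coordinates of `stepV` do not depend on the third entry of the triple. -/
theorem stepV_congr {i' : Fin 3 → ℕ} (hi : IsTriple n i) (hi' : IsTriple n i') (h0 : i' 0 = i 0)
    (h1 : i' 1 = i 1) :
    stepV n i' K (i 0, n) = stepV n i K (i 0, n) ∧ stepV n i' K (i 1, n) = stepV n i K (i 1, n) := by
  have h := hi.ne
  have h' := hi'.ne
  rw [h0, h1] at h'
  simp only [stepV_apply, rep, h0, h1]
  by_cases k0 : i 0 ∈ K <;> by_cases k1 : i 1 ∈ K <;> simp [k0, k1, h, h', h.1.symm]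

theorem reduce_congr {i' : Fin 3 → ℕ} (h0 : i' 0 = i 0) (h1 : i' 1 = i 1)
    (h : ¬ (n ∈ K ∧ i 0 ∈ K ∧ i 1 ∈ K)) : reduce n i' K = reduce n i K := by
  unfold reduce rep
  by_cases hn : n ∈ K
  · simp only [hn, true_and, not_and, if_true, h0, h1] at h ⊢
    by_cases k0 : i 0 ∈ K
    · simp [k0, h k0]
    · simp [k0]
  · simp [hn]

theorem eq_of_mem (hi : IsTriple n i) (hK : K.card = 3) (hn : n ∈ K) (h0 : i 0 ∈ K) (h1 : i 1 ∈ K) :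
    K = {n, i 0, i 1} := by
  symm
  refine Finset.eq_of_subset_of_card_le ?_ ?_
  · intro c hc
    simp only [Finset.mem_insert, Finset.mem_singleton] at hc
    rcases hc with rfl | rfl | rfl <;> assumption
  · rw [hK, Finset.card_eq_three.2]
    exact ⟨n, i 0, i 1, (hi.2 0).2.ne', (hi.2 1).2.ne', hi.ne.1, rfl⟩

theorem stepV_two (hi : IsTriple n i) :
    stepV n i K (i 2, n) = if n ∈ K ∧ i 0 ∈ K ∧ i 1 ∈ K then 1 else 0 := by
  have h := hi.ne
  simp only [stepV_apply, rep]
  by_cases k0 : i 0 ∈ K <;> by_cases k1 : i 1 ∈ K <;>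
    simp [k0, k1, h.2.1.symm, h.2.2.symm]

end Step

section Compare

variable {j i k j' i' k' : Fin 3 → ℕ} {v v' w w' : (ℕ × ℕ) →₀ ℕ} {d : ℕ → ℕ}

/-- Linear relations between the weight `v` of a monomial and its multidegree `d`. -/
structure IsCompat (j i k : Fin 3 → ℕ) (v : (ℕ × ℕ) →₀ ℕ) (d : ℕ → ℕ) : Prop where
  psi : Psi v + 2 * (d 1 + d 2 + d 3 + d 4 + d 5 + d 6) =
    d 1 + 2 * d 2 + 3 * d 3 + 4 * d 4 + 5 * d 5 + 6 * d 6
  top : v (j 0, 6) + v (j 1, 6) + v (j 2, 6) = d 6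
  top_zero : ∀ c, (∀ t, c ≠ j t) → v (c, 6) = 0
  mid : v (i 0, 5) + v (i 1, 5) + v (i 2, 5) = d 5 + v (5, 6)
  mid_zero : ∀ c, (∀ t, c ≠ i t) → v (c, 5) = 0
  base : ∀ c ∈ Finset.Icc 1 3, 3 * (d c + v (c, 6) + v (c, 5) + v (c, 4)) =
    d 1 + d 2 + d 3 + d 4 + d 5 + d 6

theorem IsCompat.zero : IsCompat j i k 0 0 := by
  constructor <;> simp [Psi]

theorem IsCompat.add {d' : ℕ → ℕ} (h : IsCompat j i k v d) (h' : IsCompat j i k v' d') :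
    IsCompat j i k (v + v') (d + d') := by
  constructor
  · have := h.psi
    have := h'.psi
    rw [Psi_add]
    simp only [Pi.add_apply]
    omega
  · have := h.top
    have := h'.top
    simp only [Pi.add_apply, Finsupp.add_apply]
    omega
  · intro c hc
    simp [h.top_zero c hc, h'.top_zero c hc]
  · have := h.mid
    have := h'.mid
    simp only [Pi.add_apply, Finsupp.add_apply]
    omega
  · intro c hc
    simp [h.mid_zero c hc, h'.mid_zero c hc]
  · intro c hc
    have := h.base c hc
    have := h'.base c hc
    simp only [Pi.add_apply, Finsupp.add_apply]
    omega

theorem sum_ind {K : Finset ℕ} (hK : K ⊆ Finset.Icc 1 6) (f : ℕ → ℕ) :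
    ∑ c ∈ K, f c = f 1 * ind K 1 + f 2 * ind K 2 + f 3 * ind K 3 + f 4 * ind K 4 + f 5 * ind K 5 +
      f 6 * ind K 6 := by
  have h : ∑ c ∈ K, f c = ∑ c ∈ Finset.Icc 1 6, if c ∈ K then f c else 0 := by
    rw [← Finset.sum_filter, Finset.filter_mem_eq_inter, Finset.inter_eq_right.2 hK]
  rw [h, show Finset.Icc 1 6 = {1, 2, 3, 4, 5, 6} by decide]
  simp [-Finset.sum_ite_mem, ind, add_assoc]

theorem isCompat_single (h : IsSeq j i k) (K : MI 6) :
    IsCompat j i k (valS 6 (seq j i k) K.1) (ind K.toFinset) := by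
  have hlead := isLeadFamily_seq h (K.1 0) (K.1 1) (K.1 2) (Finset.mem_Icc.2 (K.2.2 0))
    (Finset.mem_Icc.2 (K.2.2 1)) (Finset.mem_Icc.2 (K.2.2 2)) (K.2.1.injective.ne (by decide))
    (K.2.1.injective.ne (by decide)) (K.2.1.injective.ne (by decide))
  have hset : ({K.1 0, K.1 1, K.1 2} : Finset ℕ) = K.toFinset := by
    ext c; simp [MI.toFinset, Fin.exists_fin_succ, eq_comm]
  have hpsi := hlead.psi _ hlead.mem
  have hsum : ∑ c ∈ K.toFinset, c = K.1 0 + K.1 1 + K.1 2 := by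
    rw [MI.toFinset, Finset.sum_image fun a _ b _ hab => K.2.1.injective hab, Fin.sum_univ_three]
  rw [hset, ← hsum, sum_ind (toFinset_subset K)] at hpsi
  have hcard := card_toFinset K
  have hcard' := hcard
  rw [Finset.card_eq_sum_ones, sum_ind (toFinset_subset K)] at hcard'
  rw [valS_seq h]
  have hsub := toFinset_subset K
  generalize K.toFinset = K at *
  obtain ⟨hj, hi, hk⟩ := h
  have hsub₅ := reduce_subset hj hsub
  have hcard₅ := card_reduce hj hcard
  have hsub₄ := reduce_subset hi hsub₅
  have hcard₄ := card_reduce hi hcard₅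
  have hsub₃ := reduce_subset hk hsub₄
  have hcard₃ := card_reduce hk hcard₄
  have hred₃ : reduce 4 k (reduce 5 i (reduce 6 j K)) = Finset.Icc 1 3 :=
    Finset.eq_of_subset_of_card_le hsub₃ (by rw [hcard₃]; decide)
  constructor
  · omega
  · simpa [valSet, stepV_of_ne] using sum_stepV hj
  · intro c hc
    simp [valSet, stepV_of_ne, stepV_eq_zero hc]
  · have h₁ := sum_stepV hi (K := reduce 6 j K)
    rw [ind_reduce hj hcard (by decide)] at h₁
    simpa [valSet, stepV_of_ne] using h₁
  · intro c hc
    simp [valSet, stepV_of_ne, stepV_eq_zero hc]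
  · intro c hc
    have h₃ : ind (reduce 4 k (reduce 5 i (reduce 6 j K))) c = 1 := by
      rw [hred₃]; simp only [ind, hc, if_true]
    have : c ≤ 3 := (Finset.mem_Icc.1 hc).2
    rw [ind_reduce hk hcard₄ (by omega), ind_reduce hi hcard₅ (by omega),
      ind_reduce hj hcard (by omega)] at h₃
    simp [valSet, stepV_of_ne]
    omega

theorem isCompat_MSdot (h : IsSeq j i k) (m : MI 6 →₀ ℕ) :
    IsCompat j i k (MSdot 6 (seq j i k) m) (mdeg m) := by
  induction m using finsupp_nat_induction with
  | zero =>
    rw [MSdot_zero, mdeg_zero]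
    exact IsCompat.zero
  | add a b ha hb =>
    rw [MSdot_add, mdeg_add]
    exact ha.add hb
  | single K =>
    rw [MSdot_single, mdeg_single]
    exact isCompat_single h K

theorem IsCompat.psi_eq (h : IsCompat j i k v d) (h' : IsCompat j' i' k' w d) : Psi v = Psi w := by
  have := h.psi
  have := h'.psi
  omega

theorem IsCompat.top_eq (hv : IsCompat j i k v d) (hw : IsCompat j i k w d)
    (h0 : v (j 0, 6) = w (j 0, 6)) (h1 : v (j 1, 6) = w (j 1, 6)) (c : ℕ) : v (c, 6) = w (c, 6) := by
  by_cases hc : ∀ t, c ≠ j t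
  · rw [hv.top_zero c hc, hw.top_zero c hc]
  · push Not at hc
    obtain ⟨t, rfl⟩ := hc
    have := hv.top
    have := hw.top
    fin_cases t
    · exact h0
    · exact h1
    · simp only [Fin.reduceFinMk]; omega

theorem IsCompat.mid_eq (hv : IsCompat j i k v d) (hw : IsCompat j i k w d)
    (h : v (5, 6) = w (5, 6)) (h0 : v (i 0, 5) = w (i 0, 5)) (h1 : v (i 1, 5) = w (i 1, 5))
    (c : ℕ) : v (c, 5) = w (c, 5) := by
  by_cases hc : ∀ t, c ≠ i t
  · rw [hv.mid_zero c hc, hw.mid_zero c hc]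
  · push Not at hc
    obtain ⟨t, rfl⟩ := hc
    have := hv.mid
    have := hw.mid
    fin_cases t
    · exact h0
    · exact h1
    · simp only [Fin.reduceFinMk]; omega

/-- On monomials of the same multidegree, the order only sees the first two coordinates of the
two upper blocks. -/
theorem IsCompat.psiLE_iff (h : IsSeq j i k) (hv : IsCompat j i k v d) (hw : IsCompat j i k w d) :
    psiLE (seq j i k) v w ↔
      w (j 0, 6) < v (j 0, 6) ∨ w (j 0, 6) = v (j 0, 6) ∧
      (w (j 1, 6) < v (j 1, 6) ∨ w (j 1, 6) = v (j 1, 6) ∧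
      (w (i 0, 5) < v (i 0, 5) ∨ w (i 0, 5) = v (i 0, 5) ∧ w (i 1, 5) ≤ v (i 1, 5))) := by
  rw [psiLE_iff_of_psi_eq (hv.psi_eq hw)]
  simp only [seq, block, List.cons_append, List.nil_append, List.append_nil, lexLE_cons, lexLE_nil]
  refine or_congr_right (and_congr_right fun h0 => or_congr_right (and_congr_right fun h1 => ?_))
  have htop := hv.top_eq hw h0.symm h1.symm
  simp only [htop, lt_irrefl, true_and, false_or]
  refine or_congr_right (and_congr_right fun h2 => ?_)
  rw [le_iff_lt_or_eq]
  refine or_congr_right ⟨And.left, fun h3 => ⟨h3, ?_⟩⟩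
  have hmid := hv.mid_eq hw (htop 5) h2.symm h3.symm
  have hbase : ∀ t, v (k t, 4) = w (k t, 4) := fun t => by
    have ht := h.2.2.2 t
    have hc : k t ∈ Finset.Icc 1 3 := Finset.mem_Icc.2 ⟨ht.1, by omega⟩
    have := hv.base _ hc
    have := hw.base _ hc
    have := htop (k t)
    have := hmid (k t)
    omega
  simp [hmid, hbase]

/-- Weights of the same monomial with respect to two sequences sharing the first two entries of
the two upper triples. -/
structure IsPair (j i : Fin 3 → ℕ) (a b : ℕ × ℕ) (v v' : (ℕ × ℕ) →₀ ℕ) : Prop where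
  zero : v' (j 0, 6) = v (j 0, 6)
  one : v' (j 1, 6) = v (j 1, 6)
  midZero : v' (i 0, 5) + a.1 * v (j 2, 6) = v (i 0, 5) + b.1 * v (j 2, 6)
  midOne : v' (i 1, 5) + a.2 * v (j 2, 6) = v (i 1, 5) + b.2 * v (j 2, 6)

theorem exists_isPair (h : IsSeq j i k) (h' : IsSeq j' i' k') (hj0 : j' 0 = j 0)
    (hj1 : j' 1 = j 1) (hi0 : i' 0 = i 0) (hi1 : i' 1 = i 1) :
    ∃ a b, ∀ m, IsPair j i a b (MSdot 6 (seq j i k) m) (MSdot 6 (seq j' i' k') m) := by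
  set K₀ : Finset ℕ := {6, j 0, j 1}
  refine ⟨(stepV 5 i (reduce 6 j K₀) (i 0, 5), stepV 5 i (reduce 6 j K₀) (i 1, 5)),
    (stepV 5 i' (reduce 6 j' K₀) (i 0, 5), stepV 5 i' (reduce 6 j' K₀) (i 1, 5)), fun m => ?_⟩
  induction m using finsupp_nat_induction with
  | zero =>
    constructor <;> simp [MSdot_zero]
  | add a b ha hb =>
    simp only [MSdot_add]
    constructor
    · simp [ha.zero, hb.zero]
    · simp [ha.one, hb.one]
    · simp only [Finsupp.add_apply, mul_add]
      linarith [ha.midZero, hb.midZero]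
    · simp only [Finsupp.add_apply, mul_add]
      linarith [ha.midOne, hb.midOne]
  | single K =>
    simp only [MSdot_single, valS_seq h, valS_seq h']
    have hcard := card_toFinset K
    generalize K.toFinset = K at *
    have ht := stepV_congr h.1 h'.1 hj0 hj1 (K := K)
    have h2 := stepV_two h.1 (K := K)
    have hm := stepV_congr h.2.1 h'.2.1 hi0 hi1 (K := reduce 6 j K)
    constructor
    · simpa [valSet, stepV_of_ne] using ht.1
    · simpa [valSet, stepV_of_ne] using ht.2
    all_goals
      simp only [valSet, Finsupp.add_apply, stepV_of_ne (show 5 ≠ 6 by decide),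
        stepV_of_ne (show 5 ≠ 4 by decide), stepV_of_ne (show 6 ≠ 5 by decide),
        stepV_of_ne (show 6 ≠ 4 by decide), zero_add, add_zero, h2]
      by_cases hK : 6 ∈ K ∧ j 0 ∈ K ∧ j 1 ∈ K
      · rw [if_pos hK, eq_of_mem h.1 hcard hK.1 hK.2.1 hK.2.2]
        ring
      · rw [if_neg hK, reduce_congr hj0 hj1 hK]
        simp [hm.1, hm.2]

/-- The initial terms only depend on the first two entries of the two upper triples. -/
theorem psiLE_MSdot_congr (h : IsSeq j i k) (h' : IsSeq j' i' k') (hj0 : j' 0 = j 0)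
    (hj1 : j' 1 = j 1) (hi0 : i' 0 = i 0) (hi1 : i' 1 = i 1) {m n : MI 6 →₀ ℕ}
    (hmn : mdeg m = mdeg n) :
    psiLE (seq j' i' k') (MSdot 6 (seq j' i' k') m) (MSdot 6 (seq j' i' k') n) ↔
      psiLE (seq j i k) (MSdot 6 (seq j i k) m) (MSdot 6 (seq j i k) n) := by
  have hm := isCompat_MSdot h m
  have hn := isCompat_MSdot h n
  have hm' := isCompat_MSdot h' m
  have hn' := isCompat_MSdot h' n
  rw [hmn] at hm hm'
  rw [hm.psiLE_iff h hn, hm'.psiLE_iff h' hn']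
  obtain ⟨a, b, hab⟩ := exists_isPair h h' hj0 hj1 hi0 hi1
  have pm := hab m
  have pn := hab n
  rw [hj0, hj1, hi0, hi1, pm.zero, pm.one, pn.zero, pn.one]
  refine or_congr_right (and_congr_right fun h0 => or_congr_right (and_congr_right fun h1 => ?_))
  have h2 := hm.top_eq hn h0.symm h1.symm (j 2)
  have m0 := pm.midZero
  have m1 := pm.midOne
  have n0 := pn.midZero
  have n1 := pn.midOne
  rw [h2] at m0 m1
  omega

end Compare

section Relations

variable {I : Fin 2 → ℕ} {J : Fin 4 → ℕ} {x : ℕ}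

theorem insert3_of_le (h : I 0 < I 1) (h0 : x ≤ I 0) : insert3 I x = ![x, I 0, I 1] := by
  have h1 : ¬ I 1 ≤ x := by omega
  have e : List.insertionSort (· ≤ ·) [I 0, I 1, x] = [x, I 0, I 1] := by
    rcases h0.eq_or_lt with rfl | h0
    · simp [List.orderedInsert, h.not_ge]
    · simp [List.orderedInsert, h0.not_ge, h1, h.le]
  ext t
  fin_cases t <;> simp only [insert3, e] <;> rfl

theorem insert3_of_le_of_le (h : I 0 < I 1) (h0 : I 0 < x) (h1 : x ≤ I 1) :
    insert3 I x = ![I 0, x, I 1] := by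
  have e : List.insertionSort (· ≤ ·) [I 0, I 1, x] = [I 0, x, I 1] := by
    rcases h1.eq_or_lt with rfl | h1
    · simp [h.le]
    · simp [List.orderedInsert, h0.le, h1.not_ge]
  ext t
  fin_cases t <;> simp only [insert3, e] <;> rfl

theorem insert3_of_lt (h : I 0 < I 1) (h1 : I 1 < x) : insert3 I x = ![I 0, I 1, x] := by
  have e : List.insertionSort (· ≤ ·) [I 0, I 1, x] = [I 0, I 1, x] := by
    simp [h.le, h1.le]
  ext t
  fin_cases t <;> simp only [insert3, e] <;> rfl

theorem erase4_apply (hJ : StrictMono J) :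
    erase4 J (J 0) = ![J 1, J 2, J 3] ∧ erase4 J (J 1) = ![J 0, J 2, J 3] ∧
      erase4 J (J 2) = ![J 0, J 1, J 3] ∧ erase4 J (J 3) = ![J 0, J 1, J 2] := by
  have h01 : J 0 ≠ J 1 := hJ.injective.ne (by decide)
  have h02 : J 0 ≠ J 2 := hJ.injective.ne (by decide)
  have h03 : J 0 ≠ J 3 := hJ.injective.ne (by decide)
  have h12 : J 1 ≠ J 2 := hJ.injective.ne (by decide)
  have h13 : J 1 ≠ J 3 := hJ.injective.ne (by decide)
  have h23 : J 2 ≠ J 3 := hJ.injective.ne (by decide)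
  refine ⟨?_, ?_, ?_, ?_⟩ <;> ext t <;> fin_cases t <;>
    simp [erase4, *]

theorem insert3_cases (h : I 0 < I 1) (x : ℕ) :
    insert3 I x = ![x, I 0, I 1] ∧ x ≤ I 0 ∨ insert3 I x = ![I 0, x, I 1] ∧ I 0 < x ∧ x ≤ I 1 ∨
      insert3 I x = ![I 0, I 1, x] ∧ I 1 < x := by
  by_cases h0 : x ≤ I 0
  · exact Or.inl ⟨insert3_of_le h h0, h0⟩
  by_cases h1 : x ≤ I 1
  · exact Or.inr (Or.inl ⟨insert3_of_le_of_le h (not_le.1 h0) h1, not_le.1 h0, h1⟩)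
  · exact Or.inr (Or.inr ⟨insert3_of_lt h (not_le.1 h1), not_le.1 h1⟩)

theorem sorted_cons_iff {n x y z : ℕ} : Sorted 3 n ![x, y, z] ↔ 1 ≤ x ∧ x < y ∧ y < z ∧ z ≤ n := by
  rw [Sorted, Fin.strictMono_iff_lt_succ]
  simp [Fin.forall_fin_succ]
  omega

theorem image_cons (x y z : ℕ) : Finset.univ.image ![x, y, z] = {x, y, z} := by
  ext c
  simp [Fin.exists_fin_succ, eq_comm]

theorem image_insert3 (hI : I 0 < I 1) (x : ℕ) :
    Finset.univ.image (insert3 I x) = {x, I 0, I 1} := by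
  rcases insert3_cases hI x with ⟨h, -⟩ | ⟨h, -⟩ | ⟨h, -⟩ <;> rw [h, image_cons] <;> ext <;>
    simp <;> tauto

theorem image_erase4 (hJ : StrictMono J) (t : Fin 4) :
    Finset.univ.image (erase4 J (J t)) = (Finset.univ.image J).erase (J t) := by
  have hne : ∀ s t : Fin 4, s ≠ t → J s ≠ J t := fun s t h => hJ.injective.ne h
  have h := erase4_apply hJ
  have h' : Finset.univ.image J = {J 0, J 1, J 2, J 3} := by
    ext c
    simp [Fin.exists_fin_succ, eq_comm]
  rw [h']
  fin_cases t <;> simp only [Fin.zero_eta, Fin.mk_one, Fin.reduceFinMk, h, image_cons] <;> ext c <;>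
    simp only [Finset.mem_erase, Finset.mem_insert, Finset.mem_singleton] <;>
    have := hne 0 1 (by decide) <;> have := hne 0 2 (by decide) <;>
    have := hne 0 3 (by decide) <;> have := hne 1 2 (by decide) <;>
    have := hne 1 3 (by decide) <;> have := hne 2 3 (by decide) <;> omega

theorem sorted_insert3 {n : ℕ} (hI : Sorted 2 n I) (hx : x ∈ Finset.Icc 1 n) (hxI : ∀ t, I t ≠ x) :
    Sorted 3 n (insert3 I x) := by
  have h01 : I 0 < I 1 := hI.1 (by decide)
  have h0 := hI.2 0
  have h1 := hI.2 1
  have k0 := hxI 0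
  have k1 := hxI 1
  rw [Finset.mem_Icc] at hx
  rcases insert3_cases h01 x with ⟨h, h'⟩ | ⟨h, h'⟩ | ⟨h, h'⟩ <;> rw [h, sorted_cons_iff] <;> omega

theorem pvar_insert3_eq_zero {n : ℕ} (hI : Sorted 2 n I) (t : Fin 2) :
    pvar n (insert3 I (I t)) = 0 := by
  have h01 : I 0 < I 1 := hI.1 (by decide)
  have ht : I t = I 0 ∨ I t = I 1 := by fin_cases t <;> simp
  rw [pvar, dif_neg]
  rcases insert3_cases h01 (I t) with ⟨h, -⟩ | ⟨h, -⟩ | ⟨h, -⟩ <;> rw [h, sorted_cons_iff] <;> omega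

theorem sorted_erase4 {n : ℕ} (hJ : Sorted 4 n J) (t : Fin 4) : Sorted 3 n (erase4 J (J t)) := by
  have h := erase4_apply hJ.1
  have h01 : J 0 < J 1 := hJ.1 (by decide)
  have h12 : J 1 < J 2 := hJ.1 (by decide)
  have h23 : J 2 < J 3 := hJ.1 (by decide)
  have h0 := hJ.2 0
  have h3 := hJ.2 3
  fin_cases t <;> simp only [Fin.zero_eta, Fin.mk_one, Fin.reduceFinMk, h, sorted_cons_iff] <;> omega

theorem pvar_mul_pvar_of_notMem {n : ℕ} (hI : Sorted 2 n I) (hJ : Sorted 4 n J) {t : Fin 4}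
    (ht : ∀ s, I s ≠ J t) : ∃ K L : MI n,
      pvar n (insert3 I (J t)) * pvar n (erase4 J (J t)) =
        monomial (Finsupp.single K 1 + Finsupp.single L 1) 1 ∧
      K.toFinset = {J t, I 0, I 1} ∧ L.toFinset = (Finset.univ.image J).erase (J t) := by
  have hK := sorted_insert3 hI (Finset.mem_Icc.2 (hJ.2 t)) ht
  have hL := sorted_erase4 hJ t
  refine ⟨⟨_, hK⟩, ⟨_, hL⟩, ?_, image_insert3 (hI.1 (by decide)) _, image_erase4 hJ.1 t⟩
  rw [pvar, dif_pos hK, pvar, dif_pos hL, X, X, monomial_mul, mul_one]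

theorem pvar_mul_pvar_of_mem {n : ℕ} (hI : Sorted 2 n I) {t : Fin 4} (ht : ∃ s, I s = J t) :
    pvar n (insert3 I (J t)) * pvar n (erase4 J (J t)) = 0 := by
  obtain ⟨s, hs⟩ := ht
  rw [← hs, pvar_insert3_eq_zero hI, zero_mul]

theorem Rrel_mem_pow {n : ℕ} (I : Fin 2 → ℕ) (J : Fin 4 → ℕ) : Rrel n I J ∈ idealOfVars (MI n) ℂ ^ 2 := by
  have h : ∀ K, pvar n K ∈ idealOfVars (MI n) ℂ := fun K => by
    unfold pvar
    split_ifs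
    · exact Ideal.subset_span ⟨_, rfl⟩
    · exact zero_mem _
  rw [sq]
  exact sum_mem fun t _ => Ideal.mul_mem_left _ _ (Ideal.mul_mem_mul (h _) (h _))

theorem PluckerIdeal_le_pow (n : ℕ) : PluckerIdeal n ≤ idealOfVars (MI n) ℂ ^ 2 := by
  refine Ideal.span_le.2 ?_
  rintro _ ⟨I, J, -, -, rfl⟩
  exact Rrel_mem_pow I J

theorem Rrel_isWeightedHomogeneous {n : ℕ} (hI : Sorted 2 n I) (hJ : Sorted 4 n J) :
    IsWeightedHomogeneous (fun K : MI n => ind K.toFinset) (Rrel n I J)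
      (ind {I 0, I 1} + ind (Finset.univ.image J)) := by
  refine IsWeightedHomogeneous.sum _ _ _ fun t _ => ?_
  have hsign : ∀ c : ℕ, (-1 : PRing n) ^ c = C ((-1) ^ c) := by simp
  rw [hsign]
  refine IsWeightedHomogeneous.C_mul ?_ _
  by_cases ht : ∃ s, I s = J t
  · rw [pvar_mul_pvar_of_mem hI ht]
    exact isWeightedHomogeneous_zero ..
  · push Not at ht
    obtain ⟨K, L, h, hK, hL⟩ := pvar_mul_pvar_of_notMem hI hJ ht
    rw [h]
    refine isWeightedHomogeneous_monomial _ _ _ ?_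
    rw [map_add, Finsupp.weight_single, Finsupp.weight_single, one_smul, one_smul, hK, hL]
    have h0 := ht 0
    have h1 := ht 1
    ext c
    simp only [Pi.add_apply, ind, Finset.mem_erase, Finset.mem_insert, Finset.mem_singleton]
    by_cases hc : c = J t
    · subst hc
      simp [h0.symm, h1.symm]
    · simp [hc]

open scoped Classical in
theorem component_mem_PluckerIdeal {n : ℕ} {f : PRing n} (hf : f ∈ PluckerIdeal n) (d : ℕ → ℕ) :
    weightedHomogeneousComponent (fun K : MI n => ind K.toFinset) d f ∈ PluckerIdeal n := by
  let := weightedGradedAlgebra ℂ (fun K : MI n => ind K.toFinset)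
  refine weightedHomogeneousComponent_mem_of_mem ℂ _ ?_ hf d
  refine Ideal.homogeneous_span _ _ ?_
  rintro _ ⟨I, J, hI, hJ, rfl⟩
  exact ⟨_, Rrel_isWeightedHomogeneous hI hJ⟩

end Relations

section InitialForms

variable {n : ℕ} {S T : List (ℕ × ℕ)} {f : PRing n}

open scoped Classical in
theorem coeff_inM (m : MI n →₀ ℕ) : coeff m (inM n S f) =
    if ∀ m' ∈ f.support, psiLE S (MSdot n S m) (MSdot n S m') then coeff m f else 0 := by
  rw [inM, coeff_sum]
  simp only [coeff_monomial]
  rw [Finset.sum_ite_eq']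
  by_cases hm : m ∈ f.support
  · simp only [Finset.mem_filter, hm, true_and]
  · rw [if_neg (by simp [hm]), notMem_support_iff.1 hm, ite_self]

theorem inM_zero : inM n S 0 = 0 := by simp [inM]

theorem inM_mem_InIdeal (hf : f ∈ PluckerIdeal n) : inM n S f ∈ InIdeal n S := by
  rcases eq_or_ne f 0 with rfl | h0
  · rw [inM_zero]
    exact zero_mem _
  · exact Ideal.subset_span ⟨f, hf, h0, rfl⟩

open scoped Classical in
/-- The initial form splits into initial forms of homogeneous components. -/
theorem inM_eq_sum_inM_component (h : ∀ m m' : MI n →₀ ℕ, mdeg m = mdeg m' →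
      (psiLE S (MSdot n S m) (MSdot n S m') ↔ psiLE T (MSdot n T m) (MSdot n T m'))) :
    inM n S f = ∑ d ∈ (inM n S f).support.image mdeg,
      inM n T (weightedHomogeneousComponent (fun K : MI n => ind K.toFinset) d f) := by
  have hcoeff : ∀ d m, coeff m (weightedHomogeneousComponent (fun K : MI n => ind K.toFinset) d f) =
      if mdeg m = d then coeff m f else 0 := fun d m => coeff_weightedHomogeneousComponent ..
  ext m
  rw [coeff_sum]
  by_cases hd : mdeg m ∈ (inM n S f).support.image mdeg
  · rw [Finset.sum_eq_single_of_mem _ hd]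
    · obtain ⟨m₀, hm₀, hdeg⟩ := Finset.mem_image.1 hd
      rw [mem_support_iff, coeff_inM, ne_eq, ite_eq_right_iff, Classical.not_imp] at hm₀
      obtain ⟨hmin, hm₀⟩ := hm₀
      rw [coeff_inM, coeff_inM, hcoeff, if_pos rfl]
      by_cases hm : coeff m f = 0
      · simp [hm]
      refine if_congr ⟨fun hall m' hm' => ?_, fun hall m' hm' => ?_⟩ rfl rfl
      · rw [mem_support_iff, hcoeff, ne_eq, ite_eq_right_iff, Classical.not_imp] at hm'
        exact (h _ _ hm'.1.symm).1 (hall m' (mem_support_iff.2 hm'.2))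
      · have hm₀' := hall m₀ (by rwa [mem_support_iff, hcoeff, if_pos hdeg])
        exact psiLE_trans ((h _ _ hdeg.symm).2 hm₀') (hmin m' hm')
    · intro d _ hne
      rw [coeff_inM, hcoeff, if_neg hne.symm, ite_self]
  · have hm : coeff m (inM n S f) = 0 := by
      by_contra hm
      exact hd (Finset.mem_image_of_mem _ (mem_support_iff.2 hm))
    rw [hm, Finset.sum_eq_zero]
    intro d hd'
    have hne : mdeg m ≠ d := by
      rintro rfl
      exact hd hd'
    rw [coeff_inM, hcoeff, if_neg hne, ite_self]

theorem InIdeal_le (h : ∀ m m' : MI n →₀ ℕ, mdeg m = mdeg m' →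
      (psiLE S (MSdot n S m) (MSdot n S m') ↔ psiLE T (MSdot n T m) (MSdot n T m'))) :
    InIdeal n S ≤ InIdeal n T := by
  refine Ideal.span_le.2 ?_
  rintro _ ⟨f, hf, -, rfl⟩
  rw [SetLike.mem_coe, inM_eq_sum_inM_component h]
  exact sum_mem fun d _ => inM_mem_InIdeal (component_mem_PluckerIdeal hf d)

theorem InIdeal_seq_congr {j i k j' i' k' : Fin 3 → ℕ} (h : IsSeq j i k) (h' : IsSeq j' i' k')
    (hj0 : j' 0 = j 0) (hj1 : j' 1 = j 1) (hi0 : i' 0 = i 0) (hi1 : i' 1 = i 1) :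
    InIdeal 6 (seq j' i' k') = InIdeal 6 (seq j i k) :=
  le_antisymm (InIdeal_le fun _ _ hmm => psiLE_MSdot_congr h h' hj0 hj1 hi0 hi1 hmm)
    (InIdeal_le fun _ _ hmm => (psiLE_MSdot_congr h h' hj0 hj1 hi0 hi1 hmm).symm)

/-- A monomial that is never initial does not occur in the initial ideal. -/
theorem coeff_InIdeal_eq_zero {A B : MI n →₀ ℕ} (hB : B.degree = 2)
    (hAB : ∀ f ∈ PluckerIdeal n, coeff B f ≠ 0 → coeff A f ≠ 0)
    (hlt : ¬ psiLE T (MSdot n T B) (MSdot n T A)) {g : PRing n} (hg : g ∈ InIdeal n T) :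
    coeff B g = 0 := by
  classical
  suffices h : ∀ m ≤ B, coeff m g = 0 from h B le_rfl
  refine Submodule.span_induction ?_ (by simp) ?_ ?_ hg
  · rintro _ ⟨f, hf, -, rfl⟩ m hm
    rw [coeff_inM, ite_eq_right_iff]
    intro hmin
    rcases hm.eq_or_lt with rfl | hm
    · by_contra hne
      exact hlt (hmin A (mem_support_iff.2 (hAB f hf hne)))
    · refine (mem_pow_idealOfVars_iff' 2 f).1 (PluckerIdeal_le_pow n hf) m ?_
      rw [← hB]
      obtain ⟨c, rfl⟩ := exists_add_of_le hm.le
      rw [map_add]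
      have : c ≠ 0 := by rintro rfl; simp at hm
      have : c.degree ≠ 0 := by rwa [ne_eq, Finsupp.degree_eq_zero_iff]
      omega
  · intro x y _ _ hx hy m hm
    rw [coeff_add, hx m hm, hy m hm, add_zero]
  · intro p x _ hx m hm
    rw [smul_eq_mul, coeff_mul]
    refine Finset.sum_eq_zero fun c hc => ?_
    rw [hx c.2 (le_trans ?_ hm), mul_zero]
    rw [← Finset.HasAntidiagonal.mem_antidiagonal.1 hc]
    exact le_add_self

end InitialForms

section Evaluation

/-- The determinant of the `3 × 3` matrix with the given columns. -/
def tripleDet (p q r : Fin 3 → ℂ) : ℂ :=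
  p 0 * (q 1 * r 2 - q 2 * r 1) - p 1 * (q 0 * r 2 - q 2 * r 0) + p 2 * (q 0 * r 1 - q 1 * r 0)

/-- Evaluation of the Plücker coordinates at the row space of the matrix with columns `u`. -/
noncomputable def evalPlucker {n : ℕ} (u : ℕ → Fin 3 → ℂ) : PRing n →+* ℂ :=
  eval fun K => tripleDet (u (K.1 0)) (u (K.1 1)) (u (K.1 2))

variable {n : ℕ} {I : Fin 2 → ℕ} {J : Fin 4 → ℕ} {u : ℕ → Fin 3 → ℂ}

theorem evalPlucker_X (K : MI n) :
    evalPlucker u (X K) = tripleDet (u (K.1 0)) (u (K.1 1)) (u (K.1 2)) := by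
  simp [evalPlucker]

theorem evalPlucker_pvar {x y z : ℕ} (h : Sorted 3 n ![x, y, z]) :
    evalPlucker u (pvar n ![x, y, z]) = tripleDet (u x) (u y) (u z) := by
  rw [pvar, dif_pos h, evalPlucker_X]
  rfl

theorem evalPlucker_insert3 (hI : Sorted 2 n I) {x : ℕ} (hx : x ∈ Finset.Icc 1 n) :
    (-1) ^ (Finset.univ.filter fun b : Fin 2 => I b < x).card *
      evalPlucker u (pvar n (insert3 I x)) = tripleDet (u x) (u (I 0)) (u (I 1)) := by
  have h01 : I 0 < I 1 := hI.1 (by decide)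
  have hcard : (Finset.univ.filter fun b : Fin 2 => I b < x).card =
      (if I 0 < x then 1 else 0) + if I 1 < x then 1 else 0 := by
    rw [Finset.card_filter, Fin.sum_univ_two]
  by_cases hxI : ∃ t, I t = x
  · obtain ⟨t, rfl⟩ := hxI
    rw [pvar_insert3_eq_zero hI, map_zero, mul_zero]
    fin_cases t <;> simp only [Fin.zero_eta, Fin.mk_one, tripleDet] <;> ring
  push Not at hxI
  have h := sorted_insert3 hI hx hxI
  have h0 := hxI 0
  have h1 := hxI 1
  rw [hcard]
  rcases insert3_cases h01 x with ⟨h', hle⟩ | ⟨h', hle⟩ | ⟨h', hle⟩ <;> rw [h'] at h ⊢ <;>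
    rw [evalPlucker_pvar h]
  · rw [if_neg (by omega), if_neg (by omega)]
    simp
  · rw [if_pos (by omega), if_neg (by omega)]
    simp only [tripleDet]
    ring
  · rw [if_pos (by omega), if_pos (by omega)]
    simp only [tripleDet]
    ring

/-- The Plücker relations hold for maximal minors. -/
theorem evalPlucker_Rrel (hI : Sorted 2 n I) (hJ : Sorted 4 n J) :
    evalPlucker u (Rrel n I J) = 0 := by
  have hcard : ∀ t, (Finset.univ.filter fun b : Fin 4 => J t < J b).card = 3 - t := by
    intro t
    simp only [hJ.1.lt_iff_lt]
    fin_cases t <;> rfl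
  have hterm : ∀ t, evalPlucker u ((-1 : PRing n) ^ ((Finset.univ.filter fun b : Fin 2 => I b < J t).card +
        (Finset.univ.filter fun b : Fin 4 => J t < J b).card) *
      (pvar n (insert3 I (J t)) * pvar n (erase4 J (J t)))) =
      (-1) ^ (3 - t : ℕ) * (tripleDet (u (J t)) (u (I 0)) (u (I 1)) *
        evalPlucker u (pvar n (erase4 J (J t)))) := by
    intro t
    rw [← evalPlucker_insert3 hI (Finset.mem_Icc.2 (hJ.2 t)), hcard]
    simp only [map_mul, map_pow, map_neg, map_one, pow_add]
    ring
  have hs := sorted_erase4 hJ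
  have s0 := hs 0
  have s1 := hs 1
  have s2 := hs 2
  have s3 := hs 3
  obtain ⟨e0, e1, e2, e3⟩ := erase4_apply hJ.1
  rw [e0] at s0
  rw [e1] at s1
  rw [e2] at s2
  rw [e3] at s3
  rw [Rrel, map_sum, Finset.sum_congr rfl fun t _ => hterm t, Fin.sum_univ_four, e0, e1, e2, e3,
    evalPlucker_pvar s0, evalPlucker_pvar s1, evalPlucker_pvar s2, evalPlucker_pvar s3]
  simp only [tripleDet, Fin.isValue, Fin.coe_ofNat_eq_mod,
    Nat.reduceMod, Nat.reduceSub]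
  ring

theorem evalPlucker_eq_zero {f : PRing n} (hf : f ∈ PluckerIdeal n) : evalPlucker u f = 0 := by
  have h : PluckerIdeal n ≤ RingHom.ker (evalPlucker u) := by
    refine Ideal.span_le.2 ?_
    rintro _ ⟨I, J, hI, hJ, rfl⟩
    exact evalPlucker_Rrel hI hJ
  exact h hf

theorem toFinset_injective : Function.Injective (MI.toFinset (n := n)) := by
  intro K L h
  refine Subtype.ext ((StrictMono.range_inj K.2.1 L.2.1).1 ?_)
  have h' := congrArg (fun s : Finset ℕ => (s : Set ℕ)) h
  simpa [MI.toFinset] using h'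

theorem mem_toFinset {K : MI n} {x : ℕ} : x ∈ K.toFinset ↔ ∃ t, K.1 t = x := by
  simp [MI.toFinset]

theorem evalPlucker_X_of_apply_eq_zero {K : MI n} {t : Fin 3} (h : u (K.1 t) = 0) :
    evalPlucker u (X K) = 0 := by
  rw [evalPlucker_X]
  fin_cases t <;> simp_all [tripleDet]

theorem evalPlucker_X_of_row_eq_zero {K : MI n} (h : ∀ t, u (K.1 t) 2 = 0) :
    evalPlucker u (X K) = 0 := by
  rw [evalPlucker_X]
  simp [tripleDet, h]

theorem evalPlucker_X_of_apply_eq {K : MI n} {s t : Fin 3} (hst : s ≠ t)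
    (h : u (K.1 s) = u (K.1 t)) : evalPlucker u (X K) = 0 := by
  rw [evalPlucker_X]
  fin_cases s <;> fin_cases t <;> simp_all [tripleDet] <;> ring

theorem evalPlucker_X_ne_zero {K : MI n} {x y z : ℕ} (hK : K.toFinset = {x, y, z})
    (h : tripleDet (u x) (u y) (u z) ≠ 0) : evalPlucker u (X K) ≠ 0 := by
  have hmem : ∀ t, K.1 t = x ∨ K.1 t = y ∨ K.1 t = z := fun t => by
    have : K.1 t ∈ K.toFinset := mem_toFinset.2 ⟨t, rfl⟩
    rw [hK] at this
    simpa using this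
  have h01 : K.1 0 ≠ K.1 1 := K.2.1.injective.ne (by decide)
  have h02 : K.1 0 ≠ K.1 2 := K.2.1.injective.ne (by decide)
  have h12 : K.1 1 ≠ K.1 2 := K.2.1.injective.ne (by decide)
  rw [evalPlucker_X]
  intro h0
  apply h
  have e : ∀ p q r : Fin 3 → ℂ, tripleDet p q r = tripleDet q r p := fun p q r => by
    simp only [tripleDet]; ring
  have e' : ∀ p q r : Fin 3 → ℂ, tripleDet p q r = - tripleDet q p r := fun p q r => by
    simp only [tripleDet]; ring
  rcases hmem 0 with k0 | k0 | k0 <;> rcases hmem 1 with k1 | k1 | k1 <;>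
    first | exact absurd (k0.trans k1.symm) h01 | skip
  all_goals
    rcases hmem 2 with k2 | k2 | k2 <;>
    first | exact absurd (k0.trans k2.symm) h02 | exact absurd (k1.trans k2.symm) h12 | skip
  all_goals
    rw [k0, k1, k2] at h0
    first
    | rw [h0]
    | rw [e, h0]
    | rw [e, e, h0]
    | rw [e', h0, neg_zero]
    | rw [e, e', h0, neg_zero]
    | rw [e, e, e', h0, neg_zero]

end Evaluation

section ThreeTerm

/-- A configuration of columns with `a` parallel to `b` and `c` parallel to `r`. -/
def testVec (e a b c r : ℕ) (x : ℕ) : Fin 3 → ℂ :=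
  if x = a ∨ x = b then ![1, 0, 0] else if x = c ∨ x = r then ![0, 1, 0]
  else if x = e then ![0, 0, 1] else 0

variable {n e a b c r : ℕ}

theorem toFinset_of_evalPlucker_testVec (hd : [e, a, b, c, r].Nodup) {K : MI n}
    (hK : evalPlucker (testVec e a b c r) (X K) ≠ 0) :
    K.toFinset = {e, a, c} ∨ K.toFinset = {e, a, r} ∨ K.toFinset = {e, b, c} ∨
      K.toFinset = {e, b, r} := by
  simp only [List.nodup_cons, List.mem_cons, List.not_mem_nil, or_false, not_or] at hd
  obtain ⟨⟨ea, eb, ec, er⟩, ⟨ab, ac, ar⟩, ⟨bc, br⟩, cr, -⟩ := hd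
  have hsub : K.toFinset ⊆ {e, a, b, c, r} := by
    intro x hx
    obtain ⟨t, rfl⟩ := mem_toFinset.1 hx
    by_contra hx
    simp only [Finset.mem_insert, Finset.mem_singleton, not_or] at hx
    exact hK (evalPlucker_X_of_apply_eq_zero (t := t) (by simp [testVec, hx]))
  have he : e ∈ K.toFinset := by
    by_contra he
    refine hK (evalPlucker_X_of_row_eq_zero fun t => ?_)
    have : K.1 t ≠ e := fun h => he (mem_toFinset.2 ⟨t, h⟩)
    simp only [testVec, this, if_false]
    split_ifs <;> simp
  have hpair : ∀ x y, x ≠ y → testVec e a b c r x = testVec e a b c r y →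
      ¬ (x ∈ K.toFinset ∧ y ∈ K.toFinset) := by
    rintro x y hne hxy ⟨hx, hy⟩
    obtain ⟨s, rfl⟩ := mem_toFinset.1 hx
    obtain ⟨t, rfl⟩ := mem_toFinset.1 hy
    exact hK (evalPlucker_X_of_apply_eq (fun h => hne (by rw [h])) hxy)
  have hab := hpair a b ab (by simp [testVec])
  have hcr := hpair c r cr (by simp [testVec, Ne.symm ac, Ne.symm bc, Ne.symm ar, Ne.symm br])
  have hcard := card_toFinset K
  rw [← Finset.inter_eq_right.2 hsub, ← Finset.filter_mem_eq_inter, Finset.card_filter,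
    Finset.sum_insert (by simp; tauto), Finset.sum_insert (by simp; tauto),
    Finset.sum_insert (by simp; tauto), Finset.sum_insert (by simp; tauto),
    Finset.sum_singleton, if_pos he] at hcard
  have hext : ∀ x y, x ∈ K.toFinset → y ∈ K.toFinset → x ≠ y → e ≠ x → e ≠ y →
      K.toFinset = {e, x, y} := by
    intro x y hx hy hxy hex hey
    symm
    refine Finset.eq_of_subset_of_card_le ?_ ?_
    · simp [Finset.insert_subset_iff, he, hx, hy]
    · rw [card_toFinset K, Finset.card_eq_three.2 ⟨e, x, y, hex, hey, hxy, rfl⟩]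
  by_cases ha : a ∈ K.toFinset
  · have hb : b ∉ K.toFinset := fun hb => hab ⟨ha, hb⟩
    by_cases hc : c ∈ K.toFinset
    · exact Or.inl (hext a c ha hc ac ea ec)
    · by_cases hr : r ∈ K.toFinset
      · exact Or.inr (Or.inl (hext a r ha hr ar ea er))
      · simp [ha, hb, hc, hr] at hcard
  · by_cases hb : b ∈ K.toFinset
    · by_cases hc : c ∈ K.toFinset
      · exact Or.inr (Or.inr (Or.inl (hext b c hb hc bc eb ec)))
      · by_cases hr : r ∈ K.toFinset
        · exact Or.inr (Or.inr (Or.inr (hext b r hb hr br eb er)))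
        · simp [ha, hb, hc, hr] at hcard
    · have : ¬ (c ∈ K.toFinset ∧ r ∈ K.toFinset) := hcr
      by_cases hc : c ∈ K.toFinset <;> by_cases hr : r ∈ K.toFinset <;>
        simp_all

theorem sum_mdeg (m : MI n →₀ ℕ) : ∑ x ∈ Finset.Icc 1 n, mdeg m x = 3 * m.degree := by
  induction m using finsupp_nat_induction with
  | zero => simp [mdeg_zero]
  | add x y hx hy => simp [mdeg_add, Finset.sum_add_distrib, hx, hy, mul_add]
  | single K =>
    simp only [mdeg_single, ind, Finset.sum_ite_mem, Finset.inter_eq_right.2 (toFinset_subset K)]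
    simp [card_toFinset]

theorem exists_single_add_of_degree {σ : Type*} {m : σ →₀ ℕ} {d : ℕ} (hm : m.degree = d + 1) :
    ∃ K m', m = Finsupp.single K 1 + m' ∧ m'.degree = d := by
  have h0 : m ≠ 0 := by rintro rfl; simp at hm
  obtain ⟨K, hK⟩ := Finsupp.ne_iff.1 h0
  have hle : Finsupp.single K 1 ≤ m := by
    rw [Finsupp.single_le_iff]
    simp only [Finsupp.coe_zero, Pi.zero_apply] at hK
    omega
  obtain ⟨m', rfl⟩ := exists_add_of_le hle
  refine ⟨K, m', rfl, ?_⟩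
  rw [map_add, Finsupp.degree_single] at hm
  omega

theorem exists_of_degree_eq_two {σ : Type*} {m : σ →₀ ℕ} (hm : m.degree = 2) :
    ∃ K L, m = Finsupp.single K 1 + Finsupp.single L 1 := by
  obtain ⟨K, m', rfl, hm'⟩ := exists_single_add_of_degree hm
  obtain ⟨L, m'', rfl, hm''⟩ := exists_single_add_of_degree hm'
  rw [Finsupp.degree_eq_zero_iff] at hm''
  exact ⟨K, L, by rw [hm'', add_zero]⟩

theorem degree_pair {σ : Type*} (K L : σ) :
    (Finsupp.single K 1 + Finsupp.single L 1 : σ →₀ ℕ).degree = 2 := by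
  rw [map_add, Finsupp.degree_single, Finsupp.degree_single]

theorem eq_or_eq_of_evalPlucker_ne_zero (hd : [e, a, b, c, r].Nodup) {P Q P' Q' : MI n}
    (hP : P.toFinset = {e, a, r}) (hQ : Q.toFinset = {e, b, c}) (hP' : P'.toFinset = {e, b, r})
    (hQ' : Q'.toFinset = {e, a, c}) {m : MI n →₀ ℕ}
    (hm : mdeg m = mdeg (Finsupp.single P' 1 + Finsupp.single Q' 1))
    (h : evalPlucker (testVec e a b c r) (monomial m 1) ≠ 0) :
    m = Finsupp.single P 1 + Finsupp.single Q 1 ∨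
      m = Finsupp.single P' 1 + Finsupp.single Q' 1 := by
  have hdeg : m.degree = 2 := by
    have h₁ := sum_mdeg m
    rw [hm, sum_mdeg, degree_pair] at h₁
    omega
  obtain ⟨K, L, rfl⟩ := exists_of_degree_eq_two hdeg
  have hX : (monomial (Finsupp.single K 1 + Finsupp.single L 1) 1 : PRing n) = X K * X L := by
    rw [X, X, monomial_mul, mul_one]
  rw [hX, map_mul, mul_ne_zero_iff] at h
  have hK := toFinset_of_evalPlucker_testVec hd h.1
  have hL := toFinset_of_evalPlucker_testVec hd h.2
  rw [mdeg_add, mdeg_add, mdeg_single, mdeg_single, mdeg_single, mdeg_single, hP', hQ'] at hm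
  have hma := congrFun hm a
  have hmc := congrFun hm c
  simp only [List.nodup_cons, List.mem_cons, List.not_mem_nil, or_false, not_or] at hd
  obtain ⟨⟨ea, eb, ec, er⟩, ⟨ab, ac, ar⟩, ⟨bc, br⟩, cr, -⟩ := hd
  simp only [Pi.add_apply] at hma hmc
  rcases hK with hK | hK | hK | hK <;> rcases hL with hL | hL | hL | hL <;> rw [hK, hL] at hma hmc
  all_goals
    first
    | (have hKQ := toFinset_injective (hK.trans hQ'.symm)
       have hLP := toFinset_injective (hL.trans hP'.symm)
       exact Or.inr (by rw [hKQ, hLP, add_comm]))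
    | (have hKQ := toFinset_injective (hK.trans hP'.symm)
       have hLP := toFinset_injective (hL.trans hQ'.symm)
       exact Or.inr (by rw [hKQ, hLP]))
    | (have hKQ := toFinset_injective (hK.trans hP.symm)
       have hLP := toFinset_injective (hL.trans hQ.symm)
       exact Or.inl (by rw [hKQ, hLP]))
    | (have hKQ := toFinset_injective (hK.trans hQ.symm)
       have hLP := toFinset_injective (hL.trans hP.symm)
       exact Or.inl (by rw [hKQ, hLP, add_comm]))
    | (simp [ind, Ne.symm ea, Ne.symm ec, ab, ac, ar, Ne.symm ac, Ne.symm bc, cr] at hma hmc)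

theorem coeff_ne_zero_of_coeff_ne_zero (hd : [e, a, b, c, r].Nodup) {P Q P' Q' : MI n}
    (hP : P.toFinset = {e, a, r}) (hQ : Q.toFinset = {e, b, c}) (hP' : P'.toFinset = {e, b, r})
    (hQ' : Q'.toFinset = {e, a, c}) {f : PRing n} (hf : f ∈ PluckerIdeal n)
    (hB : coeff (Finsupp.single P' 1 + Finsupp.single Q' 1) f ≠ 0) :
    coeff (Finsupp.single P 1 + Finsupp.single Q 1) f ≠ 0 := by
  classical
  intro hA
  set B := Finsupp.single P' 1 + Finsupp.single Q' 1 with hBdef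
  have hcoeff : ∀ m, coeff m
      (weightedHomogeneousComponent (fun K : MI n => ind K.toFinset) (mdeg B) f) =
      if mdeg m = mdeg B then coeff m f else 0 := fun m => coeff_weightedHomogeneousComponent ..
  have h0 := evalPlucker_eq_zero (u := testVec e a b c r) (component_mem_PluckerIdeal hf (mdeg B))
  rw [as_sum (weightedHomogeneousComponent _ _ _), map_sum, Finset.sum_eq_single B] at h0
  · rw [← mul_one (coeff _ _), ← C_mul_monomial, map_mul, hcoeff, if_pos rfl, mul_eq_zero] at h0
    rcases h0 with h0 | h0
    · exact hB (by simpa [evalPlucker] using h0)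
    · have hX : (monomial B 1 : PRing n) = X P' * X Q' := by
        rw [X, X, monomial_mul, mul_one]
      simp only [List.nodup_cons, List.mem_cons, List.not_mem_nil, or_false, not_or] at hd
      obtain ⟨⟨ea, eb, ec, er⟩, ⟨ab, ac, ar⟩, ⟨bc, br⟩, cr, -⟩ := hd
      rw [hX, map_mul, mul_eq_zero] at h0
      rcases h0 with h0 | h0
      · refine evalPlucker_X_ne_zero hP' ?_ h0
        simp [testVec, tripleDet, ea, eb, ec, er, Ne.symm ar, Ne.symm br]
      · refine evalPlucker_X_ne_zero hQ' ?_ h0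
        simp [testVec, tripleDet, ea, eb, ec, er, Ne.symm ac, Ne.symm bc]
  · intro m hm hne
    rw [mem_support_iff, hcoeff, ne_eq, ite_eq_right_iff, Classical.not_imp] at hm
    rw [← mul_one (coeff _ _), ← C_mul_monomial, map_mul, mul_eq_zero]
    right
    by_contra h
    rcases eq_or_eq_of_evalPlucker_ne_zero hd hP hQ hP' hQ' hm.1 h with rfl | rfl
    · exact hm.2 hA
    · exact hne rfl
  · intro h
    rw [notMem_support_iff.1 h, monomial_zero, map_zero]

end ThreeTerm

section Relation

variable {n e a b c r : ℕ}

theorem exists_sorted_image (k : ℕ) {s : Finset ℕ} (hs : s ⊆ Finset.Icc 1 n) (hk : s.card = k) :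
    ∃ I : Fin k → ℕ, Sorted k n I ∧ Finset.univ.image I = s := by
  refine ⟨s.orderEmbOfFin hk, ⟨(s.orderEmbOfFin hk).strictMono, fun t => ?_⟩, ?_⟩
  · exact Finset.mem_Icc.1 (hs (Finset.orderEmbOfFin_mem s hk t))
  · exact Finset.image_orderEmbOfFin_univ s hk

theorem pair_ne {σ : Type*} {P Q P' Q' : σ} (h : P ≠ P') (h' : P ≠ Q') :
    Finsupp.single P 1 + Finsupp.single Q 1 ≠
      (Finsupp.single P' 1 + Finsupp.single Q' 1 : σ →₀ ℕ) := by
  classical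
  intro heq
  have := DFunLike.congr_fun heq P
  simp [Finsupp.single_apply, h.symm, h'.symm] at this

theorem Rrel_eq_sum (I : Fin 2 → ℕ) (J : Fin 4 → ℕ) : ∃ s : Fin 4 → ℂ, (∀ t, s t ≠ 0) ∧
    Rrel n I J = ∑ t, C (s t) * (pvar n (insert3 I (J t)) * pvar n (erase4 J (J t))) := by
  refine ⟨fun t => (-1) ^ ((Finset.univ.filter fun b : Fin 2 => I b < J t).card +
        (Finset.univ.filter fun b : Fin 4 => J t < J b).card),
    fun t => pow_ne_zero _ (by norm_num), ?_⟩
  simp only [Rrel, map_pow, map_neg, map_one]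

/-- The three-term Plücker relations. -/
theorem exists_three_term (hd : [e, a, b, c, r].Nodup)
    (hn : ∀ x ∈ [e, a, b, c, r], x ∈ Finset.Icc 1 n) :
    ∃ f ∈ PluckerIdeal n, ∃ P Q P' Q' R R' : MI n,
      P.toFinset = {e, a, r} ∧ Q.toFinset = {e, b, c} ∧ P'.toFinset = {e, b, r} ∧
      Q'.toFinset = {e, a, c} ∧ R.toFinset = {e, c, r} ∧ R'.toFinset = {e, a, b} ∧
      coeff (Finsupp.single P' 1 + Finsupp.single Q' 1) f ≠ 0 ∧
      ∀ m ∈ f.support, m = Finsupp.single P 1 + Finsupp.single Q 1 ∨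
        m = Finsupp.single P' 1 + Finsupp.single Q' 1 ∨
        m = Finsupp.single R 1 + Finsupp.single R' 1 := by
  simp only [List.nodup_cons, List.mem_cons, List.not_mem_nil, or_false, not_or] at hd
  obtain ⟨⟨ea, eb, ec, er⟩, ⟨ab, ac, ar⟩, ⟨bc, br⟩, cr, -⟩ := hd
  obtain ⟨I, hI, hIs⟩ := exists_sorted_image (n := n) 2 (s := {e, r})
    (by intro x hx; apply hn; simp at hx ⊢; tauto) (Finset.card_pair er)
  obtain ⟨J, hJ, hJs⟩ := exists_sorted_image (n := n) 4 (s := {e, a, b, c})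
    (by intro x hx; apply hn; simp at hx ⊢; tauto)
    (by rw [Finset.card_insert_of_notMem (by simp; tauto),
      Finset.card_eq_three.2 ⟨a, b, c, ab, ac, bc, rfl⟩])
  have hI2 : ({I 0, I 1} : Finset ℕ) = {e, r} := by
    rw [← hIs]
    ext
    simp [Fin.exists_fin_succ, eq_comm]
  have hImem : ∀ s, I s = e ∨ I s = r := fun s => by
    have := Finset.mem_image_of_mem I (Finset.mem_univ s)
    rw [hIs] at this
    simpa using this
  have hIe : ∃ s, I s = e := by simpa using (hIs ▸ by simp : e ∈ Finset.univ.image I)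
  have hJmem : ∀ x ∈ ({e, a, b, c} : Finset ℕ), ∃ t, J t = x := fun x hx => by
    rw [← hJs] at hx
    simpa using hx
  obtain ⟨te, he⟩ := hJmem e (by simp)
  obtain ⟨ta, ha⟩ := hJmem a (by simp)
  obtain ⟨tb, hb⟩ := hJmem b (by simp)
  obtain ⟨tc, hc⟩ := hJmem c (by simp)
  have huniv : (Finset.univ : Finset (Fin 4)) = {te, ta, tb, tc} := by
    symm
    rw [Finset.eq_univ_iff_forall]
    intro t
    have := Finset.mem_image_of_mem J (Finset.mem_univ t)
    rw [hJs] at this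
    simp only [Finset.mem_insert, Finset.mem_singleton] at this ⊢
    rw [← hJ.1.injective.eq_iff, ← hJ.1.injective.eq_iff (b := ta),
      ← hJ.1.injective.eq_iff (b := tb), ← hJ.1.injective.eq_iff (b := tc), he, ha, hb, hc]
    exact this
  have hne : ∀ {s t : Fin 4}, J s ≠ J t → s ≠ t := fun h h' => h (by rw [h'])
  obtain ⟨P, Q, hPQ, hP, hQ⟩ := pvar_mul_pvar_of_notMem hI hJ (t := ta)
    fun s => by rcases hImem s with h | h <;> rw [h, ha] <;> tauto
  obtain ⟨P', Q', hPQ', hP', hQ'⟩ := pvar_mul_pvar_of_notMem hI hJ (t := tb)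
    fun s => by rcases hImem s with h | h <;> rw [h, hb] <;> tauto
  obtain ⟨R, R', hRR', hR, hR'⟩ := pvar_mul_pvar_of_notMem hI hJ (t := tc)
    fun s => by rcases hImem s with h | h <;> rw [h, hc] <;> tauto
  rw [hI2, ha] at hP
  rw [hI2, hb] at hP'
  rw [hI2, hc] at hR
  rw [hJs, ha] at hQ
  rw [hJs, hb] at hQ'
  rw [hJs, hc] at hR'
  replace hP : P.toFinset = {e, a, r} := by rw [hP, Finset.insert_comm]
  replace hP' : P'.toFinset = {e, b, r} := by rw [hP', Finset.insert_comm]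
  replace hR : R.toFinset = {e, c, r} := by rw [hR, Finset.insert_comm]
  replace hQ : Q.toFinset = {e, b, c} := by rw [hQ]; ext; simp; grind
  replace hQ' : Q'.toFinset = {e, a, c} := by rw [hQ']; ext; simp; grind
  replace hR' : R'.toFinset = {e, a, b} := by rw [hR']; ext; simp; grind
  have aP : a ∈ P.toFinset := by rw [hP]; simp
  have rP : r ∈ P.toFinset := by rw [hP]; simp
  have cR : c ∈ R.toFinset := by rw [hR]; simp
  have rR : r ∈ R.toFinset := by rw [hR]; simp
  have aP' : a ∉ P'.toFinset := by rw [hP']; simp; tauto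
  have cP' : c ∉ P'.toFinset := by rw [hP']; simp; tauto
  have rQ' : r ∉ Q'.toFinset := by rw [hQ']; simp; tauto
  have hne1 : Finsupp.single P 1 + Finsupp.single Q 1 ≠
      (Finsupp.single P' 1 + Finsupp.single Q' 1 : MI n →₀ ℕ) :=
    pair_ne (fun h => aP' (h ▸ aP)) (fun h => rQ' (h ▸ rP))
  have hne2 : Finsupp.single R 1 + Finsupp.single R' 1 ≠
      (Finsupp.single P' 1 + Finsupp.single Q' 1 : MI n →₀ ℕ) :=
    pair_ne (fun h => cP' (h ▸ cR)) (fun h => rQ' (h ▸ rR))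
  refine ⟨Rrel n I J, Ideal.subset_span ⟨I, J, hI, hJ, rfl⟩, P, Q, P', Q', R, R', hP, hQ, hP', hQ',
    hR, hR', ?_⟩
  have hsum : ∃ x y z : ℂ, y ≠ 0 ∧ Rrel n I J =
      monomial (Finsupp.single P 1 + Finsupp.single Q 1) x +
      (monomial (Finsupp.single P' 1 + Finsupp.single Q' 1) y +
      monomial (Finsupp.single R 1 + Finsupp.single R' 1) z) := by
    obtain ⟨s, hs, hf⟩ := Rrel_eq_sum (n := n) I J
    have h0 : pvar n (insert3 I (J te)) * pvar n (erase4 J (J te)) = 0 :=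
      pvar_mul_pvar_of_mem hI (by rw [he]; exact hIe)
    refine ⟨s ta, s tb, s tc, hs tb, ?_⟩
    rw [hf, huniv, Finset.sum_insert, Finset.sum_insert, Finset.sum_insert, Finset.sum_singleton, h0,
      mul_zero, zero_add, hPQ, hPQ', hRR', C_mul_monomial, C_mul_monomial, C_mul_monomial, mul_one,
      mul_one, mul_one]
    · simpa using hne (by rwa [hb, hc])
    · simpa using ⟨hne (by rwa [ha, hb]), hne (by rwa [ha, hc])⟩
    · simpa using ⟨hne (by rwa [he, ha]), hne (by rwa [he, hb]), hne (by rwa [he, hc])⟩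
  obtain ⟨x, y, z, hy, hf⟩ := hsum
  rw [hf]
  refine ⟨by simpa [coeff_monomial, hne1, hne2] using hy, fun m hm => ?_⟩
  classical
  by_contra hcon
  simp only [not_or] at hcon
  rw [mem_support_iff] at hm
  exact hm (by simp [coeff_monomial, Ne.symm hcon.1, Ne.symm hcon.2.1, Ne.symm hcon.2.2])

end Relation

section Separation

variable {n e a b c r : ℕ}

/-- The order defined by `S` makes `p_{ebr} p_{eac}` smaller than `p_{ear} p_{ebc}` and of the same
weight as `p_{ecr} p_{eab}`. -/
def Drops (n : ℕ) (S : List (ℕ × ℕ)) (e a b c r : ℕ) : Prop :=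
  ∀ P Q P' Q' R R' : MI n, P.toFinset = {e, a, r} → Q.toFinset = {e, b, c} →
    P'.toFinset = {e, b, r} → Q'.toFinset = {e, a, c} → R.toFinset = {e, c, r} →
    R'.toFinset = {e, a, b} →
    psiLE S (MSdot n S (Finsupp.single P' 1 + Finsupp.single Q' 1))
      (MSdot n S (Finsupp.single P 1 + Finsupp.single Q 1)) ∧
    ¬ psiLE S (MSdot n S (Finsupp.single P 1 + Finsupp.single Q 1))
      (MSdot n S (Finsupp.single P' 1 + Finsupp.single Q' 1)) ∧
    MSdot n S (Finsupp.single P' 1 + Finsupp.single Q' 1) =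
      MSdot n S (Finsupp.single R 1 + Finsupp.single R' 1)

theorem InIdeal_ne_of_drops {S T : List (ℕ × ℕ)} (hd : [e, a, b, c, r].Nodup)
    (hn : ∀ x ∈ [e, a, b, c, r], x ∈ Finset.Icc 1 n) (hS : Drops n S e a b c r)
    (hT : Drops n T e b a c r) : InIdeal n S ≠ InIdeal n T := by
  obtain ⟨f, hf, P, Q, P', Q', R, R', hP, hQ, hP', hQ', hR, hR', hB, hsupp⟩ :=
    exists_three_term hd hn
  intro heq
  have hS' := hS P Q P' Q' R R' hP hQ hP' hQ' hR hR'
  have hT' := hT P' Q' P Q R R' hP' hQ' hP hQ hR (by rw [hR', Finset.pair_comm])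
  have hmem : inM n S f ∈ InIdeal n T := heq ▸ inM_mem_InIdeal hf
  refine absurd (coeff_InIdeal_eq_zero (degree_pair P' Q')
    (fun g hg => coeff_ne_zero_of_coeff_ne_zero hd hP hQ hP' hQ' hg) hT'.2.1 hmem) ?_
  rw [coeff_inM, if_pos]
  · exact hB
  · intro m hm
    rcases hsupp m hm with rfl | rfl | rfl
    · exact hS'.1
    · exact psiLE_refl _ _
    · rw [← hS'.2.2]
      exact psiLE_refl _ _

variable {q i j k : Fin 3 → ℕ}

theorem rep_eq (hq : q 0 = a ∨ q 0 = e ∧ q 1 = a) {K : Finset ℕ} (he : e ∈ K)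
    (ha : a ∉ K) : rep q K = a := by
  rcases hq with h | ⟨h, h'⟩
  · simp [rep, h, ha]
  · simp [rep, h, h', ha, he]

theorem stepV_eq_single (hq : q 0 = a ∨ q 0 = e ∧ q 1 = a) {K : Finset ℕ}
    (he : e ∈ K) (ha : a ∉ K) (hr : r ∈ K) : stepV r q K = Finsupp.single (a, r) 1 := by
  rw [stepV, if_pos hr, rep_eq hq he ha]

theorem reduce_eq_insert (hq : q 0 = a ∨ q 0 = e ∧ q 1 = a) {x : ℕ}
    (hd : [e, x, r].Nodup) (ha : a ≠ e ∧ a ≠ x ∧ a ≠ r) :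
    reduce r q {e, x, r} = {e, a, x} := by
  rw [reduce, if_pos (by simp), rep_eq hq (by simp) (by simp; tauto)]
  simp at hd
  ext y
  simp
  grind

theorem stepV_of_notMem {K : Finset ℕ} (hr : r ∉ K) : stepV r q K = 0 := by
  rw [stepV, if_neg hr]

theorem reduce_of_notMem {K : Finset ℕ} (hr : r ∉ K) : reduce r q K = K := by
  rw [reduce, if_neg hr]

theorem MSdot_pair (h : IsSeq j i k) (K L : MI 6) :
    MSdot 6 (seq j i k) (Finsupp.single K 1 + Finsupp.single L 1) =
      valSet j i k K.toFinset + valSet j i k L.toFinset := by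
  rw [MSdot_add, MSdot_single, MSdot_single, valS_seq h, valS_seq h]

theorem mdeg_pair (hd : [e, a, b, c, r].Nodup) {P Q P' Q' : MI n}
    (hP : P.toFinset = {e, a, r}) (hQ : Q.toFinset = {e, b, c})
    (hP' : P'.toFinset = {e, b, r}) (hQ' : Q'.toFinset = {e, a, c}) :
    mdeg (Finsupp.single P 1 + Finsupp.single Q 1) =
      mdeg (Finsupp.single P' 1 + Finsupp.single Q' 1) := by
  simp only [mdeg_add, mdeg_single, hP, hQ, hP', hQ']
  simp at hd
  ext y
  simp [ind]
  grind

theorem stepV_add_stepV (hq : q 0 = a ∨ q 0 = e ∧ q 1 = a) (hd : [e, a, b, c, r].Nodup) :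
    stepV r q {e, b, r} + stepV r q {e, a, c} = Finsupp.single (a, r) 1 := by
  simp at hd
  rw [stepV_eq_single (a := a) (e := e) hq (by simp) (by simp; grind) (by simp),
    stepV_of_notMem (by simp; grind), add_zero]

theorem stepV_lt (hi : IsTriple r q) (hq : q 0 = a ∨ q 0 = e ∧ q 1 = a)
    (hd : [e, a, b, c, r].Nodup) {v w : ℕ → ℕ}
    (hv : ∀ x, v x = stepV r q {e, a, r} (x, r) + stepV r q {e, b, c} (x, r))
    (hw : ∀ x, w x = stepV r q {e, b, r} (x, r) + stepV r q {e, a, c} (x, r)) :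
    v (q 0) < w (q 0) ∨ v (q 0) = w (q 0) ∧ v (q 1) < w (q 1) := by
  have hw' : ∀ x, w x = if a = x then 1 else 0 := fun x => by
    rw [hw, ← Finsupp.add_apply, stepV_add_stepV hq hd]
    simp [Finsupp.single_apply]
  simp only [List.nodup_cons, List.mem_cons, List.not_mem_nil, or_false, not_or] at hd
  obtain ⟨⟨ea, eb, ec, er⟩, ⟨ab, ac, ar⟩, ⟨bc, br⟩, cr, -⟩ := hd
  have hrep : rep q {e, a, r} ∉ ({e, a, r} : Finset ℕ) := rep_notMem hi
    (Finset.card_eq_three.2 ⟨e, a, r, ea, er, ar, rfl⟩) (by simp)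
  have hv' : ∀ x, x = e ∨ x = a → v x = 0 := fun x hx => by
    rw [hv, stepV_of_notMem (K := {e, b, c}) (by simp; tauto), stepV_apply, if_neg]
    · simp
    · rintro ⟨-, -, rfl⟩
      apply hrep
      rcases hx with hx | hx <;> simp [hx]
  rcases hq with h | ⟨h, h'⟩
  · left
    simp [h, hw', hv']
  · right
    simp [h, h', hw', hv', Ne.symm ea]

theorem drops_six (h : IsSeq j i k) (hq : j 0 = a ∨ j 0 = e ∧ j 1 = a)
    (hd : [e, a, b, c, 6].Nodup) : Drops 6 (seq j i k) e a b c 6 := by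
  intro P Q P' Q' R R' hP hQ hP' hQ' hR hR'
  have hcP := isCompat_MSdot h (Finsupp.single P 1 + Finsupp.single Q 1)
  rw [mdeg_pair hd hP hQ hP' hQ'] at hcP
  have hcP' := isCompat_MSdot h (Finsupp.single P' 1 + Finsupp.single Q' 1)
  rw [hcP.psiLE_iff h hcP', hcP'.psiLE_iff h hcP]
  simp only [MSdot_pair h, hP, hQ, hP', hQ', hR, hR']
  have hlt := stepV_lt h.1 hq hd
    (v := fun x => (valSet j i k {e, a, 6} + valSet j i k {e, b, c}) (x, 6))
    (w := fun x => (valSet j i k {e, b, 6} + valSet j i k {e, a, c}) (x, 6))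
    (fun x => by simp [valSet, stepV_apply]) (fun x => by simp [valSet, stepV_apply])
  refine ⟨by omega, by omega, ?_⟩
  have hs₁ := stepV_add_stepV hq hd
  have hd' : [e, a, c, b, 6].Nodup := by simp at hd ⊢; grind
  have hs₂ := stepV_add_stepV hq hd'
  simp at hd
  have r₁ : reduce 6 j {e, b, 6} = {e, a, b} :=
    reduce_eq_insert (e := e) hq (by simp; grind) (by grind)
  have r₂ : reduce 6 j {e, c, 6} = {e, a, c} :=
    reduce_eq_insert (e := e) hq (by simp; grind) (by grind)
  have r₃ : reduce 6 j {e, a, b} = {e, a, b} := reduce_of_notMem (by simp; grind)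
  have r₄ : reduce 6 j {e, a, c} = {e, a, c} := reduce_of_notMem (by simp; grind)
  simp only [valSet, r₁, r₂, r₃, r₄]
  rw [add_add_add_comm, hs₁, add_add_add_comm (stepV 6 j {e, c, 6}), hs₂]
  congr 1
  exact add_comm _ _

theorem drops_five (h : IsSeq j i k) (hq : i 0 = a ∨ i 0 = e ∧ i 1 = a)
    (hd : [e, a, b, c, 5].Nodup) (h6 : 6 ∉ [e, a, b, c]) : Drops 6 (seq j i k) e a b c 5 := by
  intro P Q P' Q' R R' hP hQ hP' hQ' hR hR'
  have hcP := isCompat_MSdot h (Finsupp.single P 1 + Finsupp.single Q 1)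
  rw [mdeg_pair hd hP hQ hP' hQ'] at hcP
  have hcP' := isCompat_MSdot h (Finsupp.single P' 1 + Finsupp.single Q' 1)
  rw [hcP.psiLE_iff h hcP', hcP'.psiLE_iff h hcP]
  simp only [MSdot_pair h, hP, hQ, hP', hQ', hR, hR']
  simp only [List.mem_cons, List.not_mem_nil, or_false, not_or] at h6
  have hval : ∀ x y z, 6 ≠ x → 6 ≠ y → 6 ≠ z → valSet j i k {x, y, z} =
      stepV 5 i {x, y, z} + stepV 4 k (reduce 5 i {x, y, z}) := fun x y z hx hy hz => by
    have : 6 ∉ ({x, y, z} : Finset ℕ) := by simp [hx, hy, hz]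
    rw [valSet, reduce_of_notMem this, stepV_of_notMem this, zero_add]
  obtain ⟨he, ha, hb, hc⟩ := h6
  rw [hval e a 5 he ha (by decide), hval e b c he hb hc, hval e b 5 he hb (by decide),
    hval e a c he ha hc, hval e c 5 he hc (by decide), hval e a b he ha hb]
  have hlt := stepV_lt h.2.1 hq hd
    (v := fun x => (stepV 5 i {e, a, 5} + stepV 4 k (reduce 5 i {e, a, 5}) +
      (stepV 5 i {e, b, c} + stepV 4 k (reduce 5 i {e, b, c}))) (x, 5))
    (w := fun x => (stepV 5 i {e, b, 5} + stepV 4 k (reduce 5 i {e, b, 5}) +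
      (stepV 5 i {e, a, c} + stepV 4 k (reduce 5 i {e, a, c}))) (x, 5))
    (fun x => by simp [stepV_apply]) (fun x => by simp [stepV_apply])
  have h0 : ∀ K L M N x, (stepV 5 i K + stepV 4 k L + (stepV 5 i M + stepV 4 k N)) (x, 6) = 0 :=
    fun K L M N x => by simp [stepV_apply]
  simp only [h0, lt_irrefl, true_and, false_or]
  refine ⟨by omega, by omega, ?_⟩
  have hs₁ := stepV_add_stepV hq hd
  have hd' : [e, a, c, b, 5].Nodup := by simp at hd ⊢; grind
  have hs₂ := stepV_add_stepV hq hd'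
  simp at hd
  have r₁ : reduce 5 i {e, b, 5} = {e, a, b} :=
    reduce_eq_insert (e := e) hq (by simp; grind) (by grind)
  have r₂ : reduce 5 i {e, c, 5} = {e, a, c} :=
    reduce_eq_insert (e := e) hq (by simp; grind) (by grind)
  have r₃ : reduce 5 i {e, a, b} = {e, a, b} := reduce_of_notMem (by simp; grind)
  have r₄ : reduce 5 i {e, a, c} = {e, a, c} := reduce_of_notMem (by simp; grind)
  rw [r₁, r₂, r₃, r₄, add_add_add_comm, hs₁, add_add_add_comm (stepV 5 i {e, c, 5}), hs₂]
  congr 1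
  exact add_comm _ _

theorem exists_mem_Icc_ne (x y z : ℕ) (hn : 4 ≤ n) :
    ∃ c ∈ Finset.Icc 1 n, c ≠ x ∧ c ≠ y ∧ c ≠ z := by
  have hcard : ({x, y, z} : Finset ℕ).card < (Finset.Icc 1 n).card := by
    have := Finset.card_le_three (a := x) (b := y) (c := z)
    rw [Nat.card_Icc]
    omega
  obtain ⟨c, hc, hc'⟩ := Finset.exists_mem_notMem_of_card_lt_card hcard
  simp only [Finset.mem_insert, Finset.mem_singleton, not_or] at hc'
  exact ⟨c, hc, hc'⟩

theorem eq_of_InIdeal_eq {j' i' k' : Fin 3 → ℕ} (h : IsSeq j i k) (h' : IsSeq j' i' k')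
    (heq : InIdeal 6 (seq j i k) = InIdeal 6 (seq j' i' k')) :
    j 0 = j' 0 ∧ j 1 = j' 1 ∧ i 0 = i' 0 ∧ i 1 = i' 1 := by
  have hne : ∀ e a b c r, [e, a, b, c, r].Nodup → (∀ x ∈ [e, a, b, c, r], x ∈ Finset.Icc 1 6) →
      Drops 6 (seq j i k) e a b c r → ¬ Drops 6 (seq j' i' k') e b a c r :=
    fun e a b c r hd hn hS hT => InIdeal_ne_of_drops hd hn hS hT heq
  have six : ∀ e a b, e ≠ a → e ≠ b → e ∈ Finset.Icc 1 5 → a ∈ Finset.Icc 1 5 → b ∈ Finset.Icc 1 5 →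
      (j 0 = a ∨ j 0 = e ∧ j 1 = a) → (j' 0 = b ∨ j' 0 = e ∧ j' 1 = b) → a = b := by
    intro e a b ea eb he ha hb hq hq'
    by_contra hab
    obtain ⟨c, hc, ce, ca, cb⟩ := exists_mem_Icc_ne e a b (n := 5) (by norm_num)
    simp only [Finset.mem_Icc] at he ha hb hc
    refine hne e a b c 6 (by simp; omega) (by simp; omega) (drops_six h hq (by simp; omega))
      (drops_six h' hq' (by simp; omega))
  have five : ∀ e a b, e ≠ a → e ≠ b → e ∈ Finset.Icc 1 4 → a ∈ Finset.Icc 1 4 → b ∈ Finset.Icc 1 4 →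
      (i 0 = a ∨ i 0 = e ∧ i 1 = a) → (i' 0 = b ∨ i' 0 = e ∧ i' 1 = b) → a = b := by
    intro e a b ea eb he ha hb hq hq'
    by_contra hab
    obtain ⟨c, hc, ce, ca, cb⟩ := exists_mem_Icc_ne e a b (n := 4) (by norm_num)
    simp only [Finset.mem_Icc] at he ha hb hc
    refine hne e a b c 5 (by simp; omega) (by simp; omega)
      (drops_five h hq (by simp; omega) (by simp; omega))
      (drops_five h' hq' (by simp; omega) (by simp; omega))
  have hjm : ∀ t, j t ∈ Finset.Icc 1 5 := fun t => by have := h.1.2 t; simp; omega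
  have hjm' : ∀ t, j' t ∈ Finset.Icc 1 5 := fun t => by have := h'.1.2 t; simp; omega
  have him : ∀ t, i t ∈ Finset.Icc 1 4 := fun t => by have := h.2.1.2 t; simp; omega
  have him' : ∀ t, i' t ∈ Finset.Icc 1 4 := fun t => by have := h'.2.1.2 t; simp; omega
  have hj0 : j 0 = j' 0 := by
    obtain ⟨e, he, ea, eb, -⟩ := exists_mem_Icc_ne (j 0) (j' 0) 0 (n := 5) (by norm_num)
    exact six e _ _ ea eb he (hjm 0) (hjm' 0) (Or.inl rfl) (Or.inl rfl)
  have hi0 : i 0 = i' 0 := by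
    obtain ⟨e, he, ea, eb, -⟩ := exists_mem_Icc_ne (i 0) (i' 0) 0 (n := 4) (by norm_num)
    exact five e _ _ ea eb he (him 0) (him' 0) (Or.inl rfl) (Or.inl rfl)
  refine ⟨hj0, ?_, hi0, ?_⟩
  · exact six (j 0) _ _ h.1.ne.1 (hj0 ▸ h'.1.ne.1) (hjm 0) (hjm 1) (hjm' 1) (Or.inr ⟨rfl, rfl⟩)
      (Or.inr ⟨hj0.symm, rfl⟩)
  · exact five (i 0) _ _ h.2.1.ne.1 (hi0 ▸ h'.2.1.ne.1) (him 0) (him 1) (him' 1)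
      (Or.inr ⟨rfl, rfl⟩) (Or.inr ⟨hi0.symm, rfl⟩)

end Separation

section Count

variable {n : ℕ}

/-- Complete a pair of distinct numbers below `n` to a triple, using an element of `{1, 2, 3}`. -/
def complete (x : ℕ × ℕ) : Fin 3 → ℕ :=
  ![x.1, x.2, if x.1 ≠ 1 ∧ x.2 ≠ 1 then 1 else if x.1 ≠ 2 ∧ x.2 ≠ 2 then 2 else 3]

theorem isTriple_complete {x : ℕ × ℕ} (hn : 4 ≤ n) (hx : x ∈ (Finset.Ico 1 n).offDiag) :
    IsTriple n (complete x) := by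
  obtain ⟨a, b⟩ := x
  simp only [Finset.mem_offDiag, Finset.mem_Ico] at hx
  refine ⟨?_, ?_⟩
  · intro s t
    fin_cases s <;> fin_cases t <;> simp [complete] <;> (try split_ifs) <;> omega
  · intro t
    fin_cases t <;> simp [complete]
    · omega
    · omega
    · split_ifs <;> omega

theorem IsTriple.mem_offDiag {i : Fin 3 → ℕ} (h : IsTriple n i) :
    (i 0, i 1) ∈ (Finset.Ico 1 n).offDiag := by
  simp only [Finset.mem_offDiag, Finset.mem_Ico]
  exact ⟨h.2 0, h.2 1, h.ne.1⟩

/-- The ordered pairs of first and second entries of the triples of levels `6` and `5`. -/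
def pairData : Finset ((ℕ × ℕ) × (ℕ × ℕ)) :=
  (Finset.Ico 1 6).offDiag ×ˢ (Finset.Ico 1 5).offDiag

/-- A representative of the iterated sequences with the given first and second entries. -/
def dataSeq (p : (ℕ × ℕ) × (ℕ × ℕ)) : List (ℕ × ℕ) :=
  seq (complete p.1) (complete p.2) ![1, 2, 3]

theorem isSeq_complete {p : (ℕ × ℕ) × (ℕ × ℕ)} (hp : p ∈ pairData) :
    IsSeq (complete p.1) (complete p.2) ![1, 2, 3] := by
  obtain ⟨h₁, h₂⟩ := Finset.mem_product.1 hp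
  refine ⟨isTriple_complete (by norm_num) h₁, isTriple_complete (by norm_num) h₂, ?_⟩
  exact ⟨by decide, by decide⟩

theorem setOf_InIdeal_eq_image :
    {X : Ideal (PRing 6) | ∃ S, IsIter 6 S ∧ X = InIdeal 6 S} =
      (fun p => InIdeal 6 (dataSeq p)) '' (pairData : Set ((ℕ × ℕ) × (ℕ × ℕ))) := by
  ext I
  constructor
  · rintro ⟨S, hS, rfl⟩
    obtain ⟨j, i, k, h, rfl⟩ := isIter_iff.1 hS
    have hp : ((j 0, j 1), (i 0, i 1)) ∈ pairData :=
      Finset.mem_product.2 ⟨h.1.mem_offDiag, h.2.1.mem_offDiag⟩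
    exact ⟨_, hp, InIdeal_seq_congr h (isSeq_complete hp) rfl rfl rfl rfl⟩
  · rintro ⟨p, hp, rfl⟩
    exact ⟨_, isIter_iff.2 ⟨_, _, _, isSeq_complete hp, rfl⟩, rfl⟩

theorem injOn_InIdeal_dataSeq :
    Set.InjOn (fun p => InIdeal 6 (dataSeq p)) (pairData : Set ((ℕ × ℕ) × (ℕ × ℕ))) := by
  intro p hp p' hp' heq
  obtain ⟨h₁, h₂, h₃, h₄⟩ := eq_of_InIdeal_eq (isSeq_complete hp) (isSeq_complete hp') heq
  exact Prod.ext (Prod.ext h₁ h₂) (Prod.ext h₃ h₄)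

end Count

/-- The set of initial ideals of the Plücker ideal of `Gr(3,6)` arising from iterated
sequences has exactly 240 elements. -/
theorem number_of_initial_ideals :
    {X : Ideal (PRing 6) | ∃ S, IsIter 6 S ∧ X = InIdeal 6 S}.ncard = 240 := by
  rw [setOf_InIdeal_eq_image, injOn_InIdeal_dataSeq.ncard_image, Set.ncard_coe_finset]
  simp [pairData, Finset.offDiag_card]
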